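/- arXiv:math/0608045 — 4 statements merged into one kernel-verified Lean document; each statement's English description precedes it below -/
import Mathlib

section
/- Let f be a complex polynomial of degree d ≥ 2. The Julia set J_f is a Cantor set (i.e. nonempty, compact, perfect and totally disconnected) if and only if every connected component of the filled-in Julia set K_f is a single point, i.e. K_f(x) = {x} for every x ∈ K_f. -/
open Set Filter Topology Metric

/-- A nowhere vanishing continuous function on a profinite space has a continuous logarithm. -/
theorem exists_continuous_exp_eq_of_totallyDisconnected {X : Type*} [TopologicalSpace X]
    [T2Space X] [CompactSpace X] [TotallyDisconnectedSpace X] {h : X → ℂ} (hc : Continuous h)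
    (h0 : ∀ x, h x ≠ 0) : ∃ g : X → ℂ, Continuous g ∧ ∀ x, Complex.exp (g x) = h x := by
  classical
  suffices H : ∃ T : Set X, IsClopen T ∧ univ ⊆ T ∧
      ∃ g : X → ℂ, Continuous g ∧ ∀ x ∈ T, Complex.exp (g x) = h x by
    obtain ⟨T, -, hT, g, hg, hgT⟩ := H
    exact ⟨g, hg, fun x ↦ hgT x (hT (mem_univ x))⟩
  refine isCompact_univ.induction_on (p := fun s ↦ ∃ T : Set X, IsClopen T ∧ s ⊆ T ∧
      ∃ g : X → ℂ, Continuous g ∧ ∀ x ∈ T, Complex.exp (g x) = h x) ?_ ?_ ?_ ?_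
  · exact ⟨∅, isClopen_empty, Subset.rfl, 0, continuous_const, by simp⟩
  · rintro s t hst ⟨T, hT, htT, hg⟩
    exact ⟨T, hT, hst.trans htT, hg⟩
  · rintro s t ⟨T₁, hT₁, hsT₁, g₁, hg₁, he₁⟩ ⟨T₂, hT₂, htT₂, g₂, hg₂, he₂⟩
    refine ⟨T₁ ∪ T₂, hT₁.union hT₂, union_subset_union hsT₁ htT₂, T₁.piecewise g₁ g₂,
      hg₁.piecewise (by simp [hT₁.frontier_eq]) hg₂, fun x hx ↦ ?_⟩
    by_cases hx₁ : x ∈ T₁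
    · simpa [hx₁] using he₁ x hx₁
    · simpa [hx₁] using he₂ x (hx.resolve_left hx₁)
  · intro x _
    have hcq : Continuous fun y ↦ h y / h x := hc.div_const _
    obtain ⟨T, hT, hxT, hTs⟩ := compact_exists_isClopen_in_isOpen
      (x := x) (U := {y | h y / h x ∈ ball (1 : ℂ) 1}) (isOpen_ball.preimage hcq) (by simp [h0 x])
    refine ⟨T, mem_nhdsWithin_of_mem_nhds (hT.isOpen.mem_nhds hxT), T, hT, Subset.rfl,
      T.piecewise (fun y ↦ Complex.log (h y / h x) + Complex.log (h x)) 0, ?_, fun y hy ↦ ?_⟩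
    · refine continuous_piecewise (by simp [hT.frontier_eq]) ?_ continuousOn_const
      rw [hT.isClosed.closure_eq]
      refine ContinuousOn.add (hcq.continuousOn.clog fun y hy ↦ ?_) continuousOn_const
      exact Complex.ball_one_subset_slitPlane (hTs hy)
    · simp [hy, Complex.exp_add, Complex.exp_log, h0]

/-- A translation `z ↦ z - p` has no continuous logarithm on a circle around `p`. -/
theorem not_exp_eq_sub_on_sphere {L : ℂ → ℂ} (hL : Continuous L) (p : ℂ) {r : ℝ} (hr : 0 < r)
    (h : ∀ z ∈ sphere p r, Complex.exp (L z) = z - p) : False := by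
  have hmem (t : ℝ) : p + r * Complex.exp (t * Complex.I) ∈ sphere p r := by
    simp [Complex.norm_exp_ofReal_mul_I, hr.le]
  have key := Complex.isCoveringMap_exp.eq_of_comp_eq
    (g₁ := fun t : ℝ ↦ L (p + r * Complex.exp (t * Complex.I)))
    (g₂ := fun t : ℝ ↦ L (p + r) + t * Complex.I) (by fun_prop) (by fun_prop)
    (by
      ext t
      have h1 := h _ (hmem t)
      have h2 := h _ (hmem 0)
      simp only [Complex.ofReal_zero, zero_mul, Complex.exp_zero, mul_one] at h2
      simp [h1, h2, Complex.exp_add]) 0 (by simp)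
  have h2 := congrFun key (2 * Real.pi)
  simp [Complex.exp_two_pi_mul_I] at h2

/-- A nonempty bounded open subset of the plane has no totally disconnected frontier. -/
theorem IsOpen.eq_empty_of_frontier_subset_isTotallyDisconnected {U J : Set ℂ} (hU : IsOpen U)
    (hb : Bornology.IsBounded U) (hJ : IsCompact J) (hd : IsTotallyDisconnected J)
    (hUJ : frontier U ⊆ J) : U = ∅ := by
  classical
  by_contra hne
  obtain ⟨p, hp⟩ := nonempty_iff_ne_empty.2 hne
  have hK : IsCompact (frontier U) := hJ.of_isClosed_subset isClosed_frontier hUJ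
  have : CompactSpace (frontier U) := isCompact_iff_compactSpace.1 hK
  have : TotallyDisconnectedSpace (frontier U) :=
    totallyDisconnectedSpace_subtype_iff.2 fun s hs ↦ hd s (hs.trans hUJ)
  obtain ⟨g, hg, hge⟩ := exists_continuous_exp_eq_of_totallyDisconnected
    (h := fun z : frontier U ↦ (z : ℂ) - p) (by fun_prop) (fun z hz ↦ by
      have h1 := z.2
      rw [sub_eq_zero.1 hz, hU.frontier_eq] at h1
      exact h1.2 hp)
  obtain ⟨G, hG⟩ := ContinuousMap.exists_extension'
    (isClosed_frontier (s := U)).isClosedEmbedding_subtypeVal ⟨g, hg⟩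
  have hHc : Continuous (U.piecewise (fun z ↦ Complex.exp (G z)) fun z ↦ z - p) := by
    refine Continuous.piecewise (fun z hz ↦ ?_) (by fun_prop) (by fun_prop)
    rw [← hge ⟨z, hz⟩]
    exact congrArg _ (congrFun hG ⟨z, hz⟩)
  have hH0 : ∀ z, U.piecewise (fun z ↦ Complex.exp (G z)) (fun z ↦ z - p) z ∈ ({0}ᶜ : Set ℂ) := by
    intro z
    by_cases hz : z ∈ U
    · simp [hz]
    · simpa [hz, sub_eq_zero] using fun h : z = p ↦ hz (h ▸ hp)
  obtain ⟨L, ⟨-, hL⟩, -⟩ := Complex.isCoveringMapOn_exp.existsUnique_continuousMap_lifts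
    ⟨_, hHc⟩ (a₀ := p) (Complex.exp_log (hH0 p)) hH0
  obtain ⟨r, hr0, hr⟩ := hb.subset_ball_lt 0 p
  refine not_exp_eq_sub_on_sphere L.continuous p hr0 fun z hz ↦ ?_
  have hzU : z ∉ U := fun h ↦ (mem_ball.1 (hr h)).ne hz
  simpa [hzU] using congrFun hL z

/-- The points with bounded forward orbit under a self-map of the plane. -/
def filledJuliaSet (F : ℂ → ℂ) : Set ℂ :=
  {z | Bornology.IsBounded (range fun n : ℕ ↦ F^[n] z)}

section Escape

variable {F : ℂ → ℂ} {R : ℝ}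

theorem mem_filledJuliaSet_iff {z : ℂ} :
    z ∈ filledJuliaSet F ↔ Bornology.IsBounded (range fun n : ℕ ↦ F^[n] z) :=
  Iff.rfl

theorem iterate_mem_filledJuliaSet_iff (n : ℕ) (z : ℂ) :
    F^[n] z ∈ filledJuliaSet F ↔ z ∈ filledJuliaSet F := by
  constructor
  · intro h
    refine (((finite_lt_nat n).image fun k ↦ F^[k] z).isBounded.union (mem_filledJuliaSet_iff.1 h)).subset ?_
    rintro _ ⟨k, rfl⟩
    rcases lt_or_ge k n with hk | hk
    · exact Or.inl ⟨k, hk, rfl⟩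
    · exact Or.inr ⟨k - n, by simp [← Function.iterate_add_apply, Nat.sub_add_cancel hk]⟩
  · intro h
    refine (mem_filledJuliaSet_iff.1 h).subset ?_
    rintro _ ⟨k, rfl⟩
    exact ⟨k + n, by simp [Function.iterate_add_apply]⟩

theorem two_pow_mul_le_norm_iterate (hR : 0 ≤ R) (hF : ∀ z, R ≤ ‖z‖ → 2 * ‖z‖ ≤ ‖F z‖) {z : ℂ}
    (hz : R ≤ ‖z‖) (k : ℕ) : 2 ^ k * ‖z‖ ≤ ‖F^[k] z‖ := by
  induction k with
  | zero => simp
  | succ k ih =>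
    rw [Function.iterate_succ_apply']
    have h1 : (1 : ℝ) ≤ 2 ^ k := one_le_pow₀ (by norm_num)
    have h2 := hF (F^[k] z) (by nlinarith)
    rw [pow_succ]
    linarith

theorem mem_filledJuliaSet_iff_forall_norm_le (hR : 0 < R)
    (hF : ∀ z, R ≤ ‖z‖ → 2 * ‖z‖ ≤ ‖F z‖) {z : ℂ} :
    z ∈ filledJuliaSet F ↔ ∀ n, ‖F^[n] z‖ ≤ R := by
  constructor
  · intro hz n
    by_contra! hn
    obtain ⟨M, hM⟩ := isBounded_iff_forall_norm_le.1 (mem_filledJuliaSet_iff.1 hz)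
    obtain ⟨k, hk⟩ := pow_unbounded_of_one_lt (M / R) one_lt_two
    have h1 := two_pow_mul_le_norm_iterate hR.le hF hn.le k
    have h2 := hM (F^[k] (F^[n] z)) ⟨k + n, by simp [Function.iterate_add_apply]⟩
    rw [div_lt_iff₀ hR] at hk
    have : 2 ^ k * R ≤ 2 ^ k * ‖F^[n] z‖ := by gcongr
    linarith
  · intro h
    exact mem_filledJuliaSet_iff.2
      (isBounded_iff_forall_norm_le.2 ⟨R, by rintro _ ⟨n, rfl⟩; exact h n⟩)

theorem isCompact_filledJuliaSet (hR : 0 < R) (hc : Continuous F)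
    (hF : ∀ z, R ≤ ‖z‖ → 2 * ‖z‖ ≤ ‖F z‖) : IsCompact (filledJuliaSet F) := by
  have hK : filledJuliaSet F = ⋂ n, {z | ‖F^[n] z‖ ≤ R} := by
    ext z
    simp [mem_filledJuliaSet_iff_forall_norm_le hR hF]
  refine isCompact_of_isClosed_isBounded ?_ (isBounded_iff_forall_norm_le.2 ⟨R, fun z hz ↦
    (mem_filledJuliaSet_iff_forall_norm_le hR hF).1 hz 0⟩)
  rw [hK]
  exact isClosed_iInter fun n ↦ isClosed_le (hc.iterate n).norm continuous_const

/-- Orbits starting in a compact set disjoint from the filled-in Julia set escape uniformly. -/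
theorem exists_forall_le_norm_iterate (hR : 0 < R) (hc : Continuous F)
    (hF : ∀ z, R ≤ ‖z‖ → 2 * ‖z‖ ≤ ‖F z‖) {S : Set ℂ} (hS : IsCompact S)
    (hSK : Disjoint S (filledJuliaSet F)) (M : ℝ) : ∃ n, ∀ z ∈ S, M ≤ ‖F^[n] z‖ := by
  suffices H : ∃ N, ∀ n ≥ N, ∀ z ∈ S, M ≤ ‖F^[n] z‖ from H.imp fun N h ↦ h N le_rfl
  refine hS.induction_on (p := fun s ↦ ∃ N, ∀ n ≥ N, ∀ z ∈ s, M ≤ ‖F^[n] z‖) (by simp)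
    (fun s t hst ⟨N, hN⟩ ↦ ⟨N, fun n hn z hz ↦ hN n hn z (hst hz)⟩) ?_ fun x hx ↦ ?_
  · rintro s t ⟨N₁, h₁⟩ ⟨N₂, h₂⟩
    exact ⟨max N₁ N₂, fun n hn z hz ↦ hz.elim (h₁ n (le_of_max_le_left hn) z)
      (h₂ n (le_of_max_le_right hn) z)⟩
  · have hxK := disjoint_left.1 hSK hx
    rw [mem_filledJuliaSet_iff_forall_norm_le hR hF] at hxK
    push Not at hxK
    obtain ⟨m, hm⟩ := hxK
    obtain ⟨k, hk⟩ := pow_unbounded_of_one_lt (M / R) one_lt_two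
    rw [div_lt_iff₀ hR] at hk
    refine ⟨{z | R < ‖F^[m] z‖}, mem_nhdsWithin_of_mem_nhds
      ((isOpen_lt continuous_const (hc.iterate m).norm).mem_nhds hm), k + m, fun n hn z hz ↦ ?_⟩
    rw [mem_ofPred_eq] at hz
    have h1 := two_pow_mul_le_norm_iterate hR.le hF hz.le (n - m)
    rw [← Function.iterate_add_apply, Nat.sub_add_cancel (by omega)] at h1
    have h2 : (2 : ℝ) ^ k ≤ 2 ^ (n - m) := pow_le_pow_right₀ one_le_two (by omega)
    have h3 : (2 : ℝ) ^ k * R ≤ 2 ^ (n - m) * ‖F^[m] z‖ := by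
      have := hz.le
      gcongr
    linarith

/-- If the filled-in Julia set has an isolated point, then it is a singleton. -/
theorem filledJuliaSet_eq_singleton_of_not_accPt (hR : 0 < R) (hd : Differentiable ℂ F)
    (hF : ∀ z, R ≤ ‖z‖ → 2 * ‖z‖ ≤ ‖F z‖) {x : ℂ} (hx : x ∈ filledJuliaSet F)
    (hacc : ¬ AccPt x (𝓟 (filledJuliaSet F))) : filledJuliaSet F = {x} := by
  have hiff {z : ℂ} := mem_filledJuliaSet_iff_forall_norm_le hR hF (z := z)
  rw [accPt_iff_nhds] at hacc
  push Not at hacc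
  obtain ⟨U, hU, hUK⟩ := hacc
  obtain ⟨r, hr, hrU⟩ := nhds_basis_closedBall.mem_iff.1 hU
  have hS : Disjoint (sphere x r) (filledJuliaSet F) := disjoint_left.2 fun z hz hzK ↦
    ne_of_mem_sphere hz hr.ne' (hUK z ⟨hrU (sphere_subset_closedBall hz), hzK⟩)
  obtain ⟨n, hn⟩ := exists_forall_le_norm_iterate hR hd.continuous hF (isCompact_sphere x r) hS
    (6 * R)
  have hxn : ‖F^[n] x‖ ≤ R := hiff.1 hx n
  have hfreq : ∃ᶠ z in 𝓝 x, F^[n] z ≠ F^[n] x := by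
    intro hev
    have hK : ∀ᶠ z in 𝓝 x, z = x := by
      filter_upwards [hev, hU] with z hz hzU
      rw [not_not] at hz
      refine hUK z ⟨hzU, (iterate_mem_filledJuliaSet_iff n z).1 ?_⟩
      rw [hz]
      exact (iterate_mem_filledJuliaSet_iff n x).2 hx
    have hne : ∀ᶠ z in 𝓝[≠] x, z = x := hK.filter_mono nhdsWithin_le_nhds
    obtain ⟨z, hz, hz'⟩ := (hne.and self_mem_nhdsWithin).exists
    exact hz' hz
  have himg := DiffContOnCl.ball_subset_image_closedBall (ε := 5 * R)
    (hd.iterate n).diffContOnCl hr (fun z hz ↦ by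
      have := norm_sub_norm_le (F^[n] z) (F^[n] x)
      have := hn z hz
      linarith) hfreq
  have hsub : filledJuliaSet F ⊆ {F^[n] x} := by
    intro w hw
    have hwR : ‖w‖ ≤ R := hiff.1 hw 0
    obtain ⟨z, hz, rfl⟩ := himg (mem_ball_iff_norm.2 (by
      have := norm_sub_le w (F^[n] x)
      linarith) : w ∈ _)
    rw [hUK z ⟨hrU hz, (iterate_mem_filledJuliaSet_iff n z).1 hw⟩]
    rfl
  rw [hsub hx]
  exact Subset.antisymm hsub (singleton_subset_iff.2 ((iterate_mem_filledJuliaSet_iff n x).2 hx))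

/-- A superattracting fixed point is interior to the filled-in Julia set. -/
theorem filledJuliaSet_mem_nhds_of_hasDerivAt_zero {x : ℂ} (hx : F x = x)
    (hd : HasDerivAt F 0 x) : filledJuliaSet F ∈ 𝓝 x := by
  have hev := (hasDerivAt_iff_isLittleO.1 hd).def one_pos
  obtain ⟨r, hr, hrb⟩ := Metric.eventually_nhds_iff_ball.1 hev
  refine mem_of_superset (ball_mem_nhds x hr) fun z hz ↦ ?_
  have hmaps : MapsTo F (ball x r) (ball x r) := fun w hw ↦ by
    have h1 := hrb w hw
    rw [hx] at h1
    simp only [smul_zero, sub_zero, one_mul] at h1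
    exact mem_ball_iff_norm.2 (h1.trans_lt (mem_ball_iff_norm.1 hw))
  exact isBounded_ball.subset (range_subset_iff.2 fun n ↦ hmaps.iterate n hz)

end Escape

namespace Polynomial

theorem exists_escape_radius {f : Polynomial ℂ} (hf : 2 ≤ f.natDegree) :
    ∃ R > 0, ∀ z : ℂ, R ≤ ‖z‖ → 2 * ‖z‖ ≤ ‖f.eval z‖ := by
  have hq : 0 < f.divX.degree := natDegree_pos_iff_degree_pos.1 (by
    rw [natDegree_divX_eq_natDegree_tsub_one]; omega)
  have hev := (f.divX.tendsto_norm_atTop hq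
    (tendsto_norm_cobounded_atTop (E := ℂ))).eventually_ge_atTop 3
  obtain ⟨r, -, hr⟩ := (hasBasis_cobounded_norm (E := ℂ)).eventually_iff.1 hev
  refine ⟨max r (max 1 ‖f.coeff 0‖), by positivity, fun z hz ↦ ?_⟩
  have h3 := hr (show r ≤ ‖z‖ from (le_max_left _ _).trans hz)
  have hc : ‖f.coeff 0‖ ≤ ‖z‖ := ((le_max_right _ _).trans (le_max_right _ _)).trans hz
  have hfz : f.eval z = z * f.divX.eval z + f.coeff 0 := by
    conv_lhs => rw [← X_mul_divX_add f, eval_add, eval_mul, eval_X, eval_C]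
  have h1 := norm_sub_le_norm_add (z * f.divX.eval z) (f.coeff 0)
  rw [← hfz, norm_mul] at h1
  nlinarith [norm_nonneg z]

theorem exists_eval_eq_self {f : Polynomial ℂ} (hf : 2 ≤ f.natDegree) : ∃ z, f.eval z = z := by
  have hdeg : (f - X).natDegree = f.natDegree :=
    natDegree_sub_eq_left_of_natDegree_lt (by rw [natDegree_X]; omega)
  obtain ⟨z, hz⟩ := IsAlgClosed.exists_root (f - X) (natDegree_pos_iff_degree_pos.1 (by omega)).ne'
  exact ⟨z, by simpa [sub_eq_zero] using hz⟩

theorem derivative_eval_eq_zero_of_unique_preimage {f : Polynomial ℂ} (hf : 2 ≤ f.natDegree)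
    {x y : ℂ} (h : ∀ z, f.eval z = y → z = x) : f.derivative.eval x = 0 := by
  have hdeg : (f - C y).natDegree = f.natDegree := natDegree_sub_C
  have h0 : f - C y ≠ 0 := ne_zero_of_natDegree_gt (n := 0) (by omega)
  have hroots : (f - C y).roots = Multiset.replicate f.natDegree x := by
    refine Multiset.eq_replicate.2 ⟨?_, fun z hz ↦ h z ?_⟩
    · rw [← (IsAlgClosed.splits (f - C y)).natDegree_eq_card_roots, hdeg]
    · simpa [sub_eq_zero] using (mem_roots'.1 hz).2
  have hmult : 1 < (f - C y).rootMultiplicity x := by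
    rw [← count_roots, hroots, Multiset.count_replicate_self]
    omega
  simpa using ((one_lt_rootMultiplicity_iff_isRoot h0).1 hmult).2

theorem preperfect_filledJuliaSet {f : Polynomial ℂ} (hf : 2 ≤ f.natDegree) :
    Preperfect (filledJuliaSet fun w ↦ f.eval w) := by
  intro x hx
  by_contra hacc
  obtain ⟨R, hR, hF⟩ := exists_escape_radius hf
  have hK := filledJuliaSet_eq_singleton_of_not_accPt hR f.differentiable hF hx hacc
  have hpre (z : ℂ) : f.eval z ∈ filledJuliaSet (fun w ↦ f.eval w) ↔
      z ∈ filledJuliaSet fun w ↦ f.eval w := iterate_mem_filledJuliaSet_iff 1 z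
  simp only [hK, mem_singleton_iff] at hpre
  have hd := f.hasDerivAt x
  rw [derivative_eval_eq_zero_of_unique_preimage hf fun z ↦ (hpre z).1] at hd
  have hnhds := filledJuliaSet_mem_nhds_of_hasDerivAt_zero ((hpre x).2 rfl) hd
  rw [hK] at hnhds
  exact (isOpen_singleton_iff_nhds_eq_pure x).not.1 (not_isOpen_singleton x)
    (le_antisymm (le_pure_iff.2 hnhds) (pure_le_nhds x))

end Polynomial

/-- The Julia set of a complex polynomial of degree `≥ 2` is a Cantor set if and only if
every connected component of the filled-in Julia set is a single point. -/
theorem julia_cantor_iff_components_points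
    (f : Polynomial ℂ) (d : ℕ) (hd : 2 ≤ d) (hdeg : f.natDegree = d)
    (Kf : Set ℂ)
    (hKf : Kf = {z : ℂ | Bornology.IsBounded
      (Set.range fun n : ℕ => (fun w : ℂ => f.eval w)^[n] z)})
    (Jf : Set ℂ) (hJf : Jf = frontier Kf) :
    (Jf.Nonempty ∧ IsCompact Jf ∧ Perfect Jf ∧ IsTotallyDisconnected Jf) ↔
      (∀ x ∈ Kf, connectedComponentIn Kf x = {x}) := by
  subst hdeg hJf
  obtain ⟨R, hR, hF⟩ := Polynomial.exists_escape_radius hd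
  have hK : Kf = filledJuliaSet fun w ↦ f.eval w := hKf
  have hcomp : IsCompact Kf := hK ▸ isCompact_filledJuliaSet hR f.continuous hF
  constructor
  · rintro ⟨-, hJc, -, hJd⟩ x hx
    have hint := isOpen_interior.eq_empty_of_frontier_subset_isTotallyDisconnected
      (hcomp.isBounded.subset interior_subset) hJc hJd frontier_interior_subset
    have hfr : frontier Kf = Kf := by rw [hcomp.isClosed.frontier_eq, hint, sdiff_empty]
    rw [hfr] at hJd
    exact (hJd _ (connectedComponentIn_subset Kf x)
      isPreconnected_connectedComponentIn).eq_singleton_of_mem (mem_connectedComponentIn hx)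
  · intro h
    have htd : IsTotallyDisconnected Kf := fun s hs hsp x hx y hy ↦ by
      have := hsp.subset_connectedComponentIn hx hs hy
      rw [h x (hs hx)] at this
      exact this.symm
    have hint := isOpen_interior.eq_empty_of_frontier_subset_isTotallyDisconnected
      (hcomp.isBounded.subset interior_subset) hcomp htd
      (frontier_interior_subset.trans hcomp.isClosed.frontier_subset)
    have hfr : frontier Kf = Kf := by rw [hcomp.isClosed.frontier_eq, hint, sdiff_empty]
    rw [hfr]
    obtain ⟨z, hz⟩ := Polynomial.exists_eval_eq_self hd
    refine ⟨⟨z, ?_⟩, hcomp, ⟨hcomp.isClosed, hK ▸ Polynomial.preperfect_filledJuliaSet hd⟩, htd⟩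
    rw [hK, mem_filledJuliaSet_iff_forall_norm_le hR hF]
    intro n
    rw [Function.iterate_fixed hz]
    by_contra! hlt
    have := hF z hlt.le
    rw [hz] at this
    linarith
end

section
/- Let f be a complex polynomial of degree d ≥ 2 whose Julia set J_f is disconnected, and let K be a connected component of the filled-in Julia set K_f. If there exist integers n ≥ 0 and m ≥ 1 such that f^{n+m}(K) = f^n(K) (so that f^n(K) is a periodic component of K_f) and some component in the cycle f^n(K), f^{n+1}(K), …, f^{n+m-1}(K) contains a critical point of f, then K is not a single point. -/
open Filter Topology in
/-- A fixed point at which the derivative vanishes is the centre of a forward-invariant ball. -/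
theorem exists_mapsTo_ball_of_hasDerivAt_zero {g : ℂ → ℂ} {p : ℂ} (hp : g p = p)
    (hg : HasDerivAt g 0 p) : ∃ r > 0, Set.MapsTo g (Metric.ball p r) (Metric.ball p r) := by
  have h : ∀ᶠ w in 𝓝 p, ‖g w - p‖ ≤ 1 * ‖w - p‖ := by
    simpa [hp] using hg.isLittleO.bound one_pos
  obtain ⟨r, hr, hball⟩ := Metric.eventually_nhds_iff_ball.1 h
  refine ⟨r, hr, fun w hw => ?_⟩
  have hgw := hball w hw
  rw [Metric.mem_ball, dist_eq_norm] at hw ⊢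
  linarith

/-- If an iterate of a continuous map preserves a bounded set, orbits starting there are bounded. -/
theorem isBounded_orbit_of_mapsTo_iterate {X : Type*} [PseudoMetricSpace X] [ProperSpace X]
    {F : X → X} (hF : Continuous F) {m : ℕ} (hm : 0 < m) {B : Set X} (hB : Bornology.IsBounded B)
    (hmaps : Set.MapsTo F^[m] B B) {w : X} (hw : w ∈ B) :
    Bornology.IsBounded (Set.range fun i : ℕ => F^[i] w) := by
  have hbdd : Bornology.IsBounded (⋃ j ∈ Set.Iio m, F^[j] '' closure B) :=
    (Bornology.isBounded_biUnion (Set.finite_Iio m)).2 fun j _ =>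
      (hB.isCompact_closure.image (hF.iterate j)).isBounded
  refine hbdd.subset ?_
  rintro _ ⟨i, rfl⟩
  refine Set.mem_biUnion (Nat.mod_lt i hm) ⟨(F^[m])^[i / m] w,
    subset_closure (hmaps.iterate _ hw), ?_⟩
  rw [← Function.iterate_mul, ← Function.iterate_add_apply, Nat.mod_add_div]

/-- An iterate of a differentiable map has zero derivative at a point whose orbit meets a critical
point along the way. -/
theorem hasDerivAt_iterate_zero_of_critical {F : ℂ → ℂ} (hF : Differentiable ℂ F) {p : ℂ}
    {j m : ℕ} (hj : j < m) (hc : HasDerivAt F 0 (F^[j] p)) : HasDerivAt F^[m] 0 p := by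
  obtain ⟨k, rfl⟩ := Nat.exists_eq_add_of_lt hj
  have h₁ := ((hF.iterate j) p).hasDerivAt
  have h₂ := ((hF.iterate k) (F (F^[j] p))).hasDerivAt
  have h := h₂.comp p (hc.comp p h₁)
  rw [zero_mul, mul_zero] at h
  rwa [show j + k + 1 = k + (1 + j) by ring, Function.iterate_add, Function.iterate_add,
    Function.iterate_one]

/-- For a polynomial of degree `≥ 2` with disconnected Julia set: a connected component
`K` of the filled-in Julia set whose forward orbit is eventually periodic, with a
critical point in the periodic cycle, is not a single point. -/
theorem periodic_component_with_critical_point_not_point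
    (f : Polynomial ℂ) (d : ℕ) (hd : 2 ≤ d) (hdeg : f.natDegree = d)
    (Kf : Set ℂ)
    (hKf : Kf = {z : ℂ | Bornology.IsBounded
      (Set.range fun n : ℕ => (fun w : ℂ => f.eval w)^[n] z)})
    (Jf : Set ℂ) (hJf : Jf = frontier Kf)
    (hdis : ¬ IsConnected Jf)
    (K : Set ℂ) (hKcomp : ∃ x ∈ Kf, K = connectedComponentIn Kf x)
    (n m : ℕ) (hm : 1 ≤ m)
    (hper : (fun w : ℂ => f.eval w)^[n + m] '' K = (fun w : ℂ => f.eval w)^[n] '' K)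
    (hcrit : ∃ j < m, ∃ c : ℂ, f.derivative.eval c = 0 ∧
      c ∈ (fun w : ℂ => f.eval w)^[n + j] '' K) :
    ¬ ∃ z : ℂ, K = {z} := by
  rintro ⟨z, rfl⟩
  obtain ⟨x, hx, hKx⟩ := hKcomp
  obtain rfl : x = z := by
    have := mem_connectedComponentIn hx
    rwa [← hKx] at this
  set F : ℂ → ℂ := fun w => f.eval w with hFdef
  have hF : Differentiable ℂ F := f.differentiable
  obtain ⟨j, hj, c, hc, hcK⟩ := hcrit
  rw [Set.image_singleton, Set.mem_singleton_iff, add_comm n j,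
    Function.iterate_add_apply] at hcK
  rw [Set.image_singleton, Set.image_singleton, Set.singleton_eq_singleton_iff, add_comm n m,
    Function.iterate_add_apply] at hper
  have hFc : HasDerivAt F 0 (F^[j] (F^[n] x)) := by
    rw [← hcK, ← hc]
    exact f.hasDerivAt c
  obtain ⟨r, hr, hmaps⟩ := exists_mapsTo_ball_of_hasDerivAt_zero hper
    (hasDerivAt_iterate_zero_of_critical hF hj hFc)
  have hpre : F^[n] ⁻¹' Metric.ball (F^[n] x) r ⊆ Kf := by
    intro w hw
    have hbdd := isBounded_orbit_of_mapsTo_iterate hF.continuous hm Metric.isBounded_ball hmaps hw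
    rw [hKf]
    refine (((Set.finite_Iio n).image fun i => F^[i] w).isBounded.union hbdd).subset ?_
    rintro _ ⟨i, rfl⟩
    rcases lt_or_ge i n with hi | hi
    · exact Or.inl ⟨i, hi, rfl⟩
    · refine Or.inr ⟨i - n, ?_⟩
      simp only [← Function.iterate_add_apply, Nat.sub_add_cancel hi]
  have hnhds : F^[n] ⁻¹' Metric.ball (F^[n] x) r ∈ nhds x :=
    (hF.continuous.iterate n).continuousAt (Metric.ball_mem_nhds _ hr)
  obtain ⟨ε, hε, hball⟩ := Metric.mem_nhds_iff.1 hnhds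
  have hsub : Metric.ball x ε ⊆ {x} := by
    rw [hKx]
    exact (convex_ball x ε).isPreconnected.subset_connectedComponentIn
      (Metric.mem_ball_self hε) (hball.trans hpre)
  exact not_isOpen_singleton x
    (Metric.isOpen_singleton_iff.2 ⟨ε, hε, fun y hy => hsub hy⟩)
end

section
/- Let f be a complex polynomial of degree d ≥ 2 whose Julia set J_f is disconnected, and let K be a connected component of the filled-in Julia set K_f. If there exist integers n ≥ 0 and m ≥ 1 such that f^{n+m}(K) = f^n(K) (so that f^n(K) is a periodic component of K_f) and no component in the cycle f^n(K), f^{n+1}(K), …, f^{n+m-1}(K) contains a critical point of f, then K is a single point. -/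
open Polynomial Set Filter Topology

/-! ### Nested intersections and polynomial images of components -/

theorem isPreconnected_iInter_of_antitone {X : Type*} [TopologicalSpace X] [T2Space X]
    (s : ℕ → Set X) (hs : Antitone s) (hc : ∀ n, IsCompact (s n))
    (hp : ∀ n, IsPreconnected (s n)) : IsPreconnected (⋂ n, s n) := by
  have hcl : IsClosed (⋂ n, s n) := isClosed_iInter fun n => (hc n).isClosed
  have hcomp : IsCompact (⋂ n, s n) := (hc 0).of_isClosed_subset hcl (iInter_subset _ 0)
  rw [isPreconnected_closed_iff]
  intro t t' ht ht' hsub hne hne'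
  by_contra hcon
  have hd : Disjoint ((⋂ n, s n) ∩ t) ((⋂ n, s n) ∩ t') := by
    rw [Set.disjoint_left]
    rintro x ⟨h1, h2⟩ ⟨_, h3⟩
    exact hcon ⟨x, h1, h2, h3⟩
  obtain ⟨u, u', hu, hu', hsu, hsu', huu⟩ :=
    SeparatedNhds.of_isCompact_isCompact (hcomp.inter_right ht) (hcomp.inter_right ht') hd
  obtain ⟨N, hN⟩ : ∃ N, s N ⊆ u ∪ u' := by
    have := exists_subset_nhds_of_isCompact (V := s) (hs.directed_ge) hc
      (U := u ∪ u') (fun x hx => (hu.union hu').mem_nhds <| by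
        rcases hsub hx with h | h
        · exact Or.inl (hsu ⟨hx, h⟩)
        · exact Or.inr (hsu' ⟨hx, h⟩))
    exact this
  obtain ⟨x, hx, hxt⟩ := hne
  obtain ⟨y, hy, hyt⟩ := hne'
  obtain ⟨z, -, hz1, hz2⟩ := hp N u u' hu hu' hN
    ⟨x, mem_iInter.1 hx N, hsu ⟨hx, hxt⟩⟩ ⟨y, mem_iInter.1 hy N, hsu' ⟨hy, hyt⟩⟩
  exact Set.disjoint_left.1 huu hz1 hz2

theorem closure_connectedComponentIn_inter_subset {X : Type*} [TopologicalSpace X]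
    (W : Set X) (x : X) :
    closure (connectedComponentIn W x) ∩ W ⊆ connectedComponentIn W x := by
  rintro z ⟨hz, hzW⟩
  by_cases hx : x ∈ W
  · have h1 : IsPreconnected (insert z (connectedComponentIn W x)) :=
      isPreconnected_connectedComponentIn.subset_closure (subset_insert _ _)
        (insert_subset hz subset_closure)
    exact h1.subset_connectedComponentIn (mem_insert_of_mem _ (mem_connectedComponentIn hx))
      (insert_subset hzW (connectedComponentIn_subset _ _)) (mem_insert _ _)
  · simp [connectedComponentIn_eq_empty hx] at hz

theorem Polynomial.image_connectedComponentIn_preimage (q : ℂ[X]) (hq : q.natDegree ≠ 0)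
    {W : Set ℂ} (hW : IsOpen W) {x : ℂ} (hx : q.eval x ∈ W) :
    q.eval '' connectedComponentIn (q.eval ⁻¹' W) x = connectedComponentIn W (q.eval x) := by
  have hxE : x ∈ connectedComponentIn (q.eval ⁻¹' W) x := mem_connectedComponentIn hx
  have hsub : q.eval '' connectedComponentIn (q.eval ⁻¹' W) x ⊆
      connectedComponentIn W (q.eval x) := by
    refine IsPreconnected.subset_connectedComponentIn
      (isPreconnected_connectedComponentIn.image _ q.continuous.continuousOn)
      (mem_image_of_mem _ hxE) ?_
    rintro _ ⟨z, hz, rfl⟩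
    exact connectedComponentIn_subset (q.eval ⁻¹' W) x hz
  refine hsub.antisymm ?_
  have hopen : IsOpen (q.eval '' connectedComponentIn (q.eval ⁻¹' W) x) :=
    (q.isOpenQuotientMap_eval hq).isOpenMap _
      ((hW.preimage q.continuous).connectedComponentIn)
  refine isPreconnected_connectedComponentIn.subset_of_closure_inter_subset hopen
    ⟨q.eval x, mem_connectedComponentIn hx, mem_image_of_mem _ hxE⟩ ?_
  rintro w ⟨hw, hwB⟩
  have hclosed : IsClosed (q.eval '' closure (connectedComponentIn (q.eval ⁻¹' W) x)) :=
    q.isClosedMap_eval _ isClosed_closure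
  obtain ⟨z, hz, rfl⟩ := closure_minimal (image_mono subset_closure) hclosed hw
  exact ⟨z, closure_connectedComponentIn_inter_subset _ _
    ⟨hz, connectedComponentIn_subset W _ hwB⟩, rfl⟩

/-! ### Escape to infinity and sublevel sets of the iterates -/

theorem Polynomial.exists_escape_radius_s3 (f : ℂ[X]) (hf : 2 ≤ f.natDegree) :
    ∃ R : ℝ, 0 < R ∧ ∀ z, R ≤ ‖z‖ → 2 * ‖z‖ ≤ ‖f.eval z‖ := by
  have hdeg : 0 < f.divX.degree := by
    rw [← natDegree_pos_iff_degree_pos, natDegree_divX_eq_natDegree_tsub_one]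
    omega
  have ht := tendsto_norm_atTop f.divX hdeg (tendsto_norm_cocompact_atTop (E := ℂ))
  have h1 := ht.eventually_ge_atTop (3 : ℝ)
  rw [← Metric.cobounded_eq_cocompact, ← comap_norm_atTop] at h1
  obtain ⟨s, hs, h1⟩ := Filter.eventually_comap.1 h1 |>.exists_mem
  obtain ⟨A, hA⟩ := Filter.mem_atTop_sets.1 hs
  refine ⟨max (max A ‖f.coeff 0‖) 1, by positivity, fun z hz => ?_⟩
  have hz1 : A ≤ ‖z‖ := (le_max_left _ _).trans ((le_max_left _ _).trans hz)
  have hz2 : ‖f.coeff 0‖ ≤ ‖z‖ := (le_max_right _ _).trans ((le_max_left _ _).trans hz)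
  have h3 := h1 ‖z‖ (hA _ hz1) z rfl
  have h4 : f.eval z = f.divX.eval z * z + f.coeff 0 := by
    conv_lhs => rw [← divX_mul_X_add f]
    simp
  have h5 : ‖f.divX.eval z * z‖ ≤ ‖f.eval z‖ + ‖f.coeff 0‖ := by
    rw [h4]; exact norm_le_add_norm_add _ _
  rw [norm_mul] at h5
  nlinarith [norm_nonneg z]

/-- The `n`-th iterate of a polynomial under composition. -/
noncomputable def Polynomial.iter (f : ℂ[X]) (n : ℕ) : ℂ[X] := f.comp^[n] X

theorem Polynomial.eval_iter (f : ℂ[X]) (n : ℕ) :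
    (f.iter n).eval = (fun w : ℂ => f.eval w)^[n] := by
  funext z
  simp [iter, iterate_comp_eval]

theorem Polynomial.eval_iter_add (f : ℂ[X]) (n k : ℕ) (z : ℂ) :
    (f.iter (n + k)).eval z = (f.iter n).eval ((f.iter k).eval z) := by
  simp [iter, iterate_comp_eval, Function.iterate_add_apply]

theorem Polynomial.eval_iter_succ (f : ℂ[X]) (n : ℕ) (z : ℂ) :
    (f.iter (n + 1)).eval z = f.eval ((f.iter n).eval z) := by
  simp [iter, iterate_comp_eval, Function.iterate_succ_apply']

theorem Polynomial.natDegree_iter (f : ℂ[X]) (n : ℕ) :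
    (f.iter n).natDegree = f.natDegree ^ n := by
  simp [iter, natDegree_iterate_comp]

/-- The points whose `n`-th iterate has norm less than `R`. -/
def Polynomial.sublevel (f : ℂ[X]) (R : ℝ) (n : ℕ) : Set ℂ := {z | ‖(f.iter n).eval z‖ < R}

/-- The points with bounded forward orbit. -/
def Polynomial.filledJulia (f : ℂ[X]) : Set ℂ :=
  {z : ℂ | Bornology.IsBounded (Set.range fun n : ℕ => (fun w : ℂ => f.eval w)^[n] z)}

/-- `R` is an escape radius for `f`: outside the disc of radius `R` the norm at least doubles. -/
def Polynomial.IsEscapeRadius (f : ℂ[X]) (R : ℝ) : Prop :=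
  0 < R ∧ ∀ z, R ≤ ‖z‖ → 2 * ‖z‖ ≤ ‖f.eval z‖

section Escape

variable {f : ℂ[X]} {R : ℝ}

theorem Polynomial.isOpen_sublevel (f : ℂ[X]) (R : ℝ) (n : ℕ) : IsOpen (f.sublevel R n) :=
  isOpen_lt (f.iter n).continuous.norm continuous_const

theorem Polynomial.preimage_sublevel (f : ℂ[X]) (R : ℝ) (n k : ℕ) :
    (f.iter k).eval ⁻¹' f.sublevel R n = f.sublevel R (n + k) := by
  ext z
  simp [sublevel, eval_iter_add]

theorem Polynomial.IsEscapeRadius.closure_sublevel_subset (h : f.IsEscapeRadius R) (n : ℕ) :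
    closure (f.sublevel R (n + 1)) ⊆ f.sublevel R n := by
  have h1 : closure (f.sublevel R (n + 1)) ⊆ {z | ‖(f.iter (n + 1)).eval z‖ ≤ R} :=
    closure_minimal (fun z hz => (show ‖(f.iter (n + 1)).eval z‖ < R from hz).le)
      (isClosed_le (f.iter _).continuous.norm continuous_const)
  intro z hz
  have h2 := h1 hz
  simp only [mem_ofPred_eq, eval_iter_succ] at h2
  by_contra h3
  simp only [sublevel, mem_ofPred_eq, not_lt] at h3
  have h4 := h.2 _ h3
  linarith [h.1]

theorem Polynomial.IsEscapeRadius.antitone_sublevel (h : f.IsEscapeRadius R) :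
    Antitone (f.sublevel R) :=
  antitone_nat_of_succ_le fun n => subset_closure.trans (h.closure_sublevel_subset n)

theorem Polynomial.IsEscapeRadius.isCompact_closure_sublevel (h : f.IsEscapeRadius R) (n : ℕ) :
    IsCompact (closure (f.sublevel R n)) := by
  refine Bornology.IsBounded.isCompact_closure ?_
  refine (Metric.isBounded_ball (x := (0 : ℂ)) (r := R)).subset ?_
  refine (h.antitone_sublevel (Nat.zero_le n)).trans ?_
  intro z hz
  simpa [sublevel, iter] using hz

theorem Polynomial.IsEscapeRadius.filledJulia_eq (h : f.IsEscapeRadius R) :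
    f.filledJulia = ⋂ n, f.sublevel R n := by
  ext z
  simp only [filledJulia, mem_ofPred_eq, mem_iInter, ← eval_iter]
  constructor
  · intro hb n
    by_contra hn
    simp only [sublevel, mem_ofPred_eq, not_lt] at hn
    have key : ∀ k, R * 2 ^ k ≤ ‖(f.iter (n + k)).eval z‖ := by
      intro k
      induction k with
      | zero => simpa using hn
      | succ k ih =>
        rw [← add_assoc, eval_iter_succ]
        have h1 : R ≤ ‖(f.iter (n + k)).eval z‖ := by
          refine le_trans ?_ ih
          nlinarith [h.1, one_le_pow₀ (M₀ := ℝ) (a := 2) (by norm_num) (n := k)]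
        have h2 := h.2 _ h1
        rw [pow_succ]
        linarith
    obtain ⟨C, hC⟩ := hb.exists_norm_le
    have hC' : ∀ k, R * 2 ^ k ≤ C := fun k => (key k).trans (hC _ ⟨n + k, rfl⟩)
    have ht : Tendsto (fun k : ℕ => R * 2 ^ k) atTop atTop :=
      (tendsto_pow_atTop_atTop_of_one_lt (by norm_num)).const_mul_atTop h.1
    obtain ⟨k, hk⟩ := (ht.eventually_gt_atTop C).exists
    linarith [hC' k]
  · intro hz
    refine (Metric.isBounded_ball (x := (0 : ℂ)) (r := R)).subset ?_
    rintro _ ⟨k, rfl⟩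
    simpa [sublevel] using hz k

theorem Polynomial.IsEscapeRadius.connectedComponentIn_filledJulia (h : f.IsEscapeRadius R)
    {x : ℂ} (hx : x ∈ f.filledJulia) :
    connectedComponentIn f.filledJulia x =
      ⋂ n, connectedComponentIn (f.sublevel R n) x := by
  have hxn : ∀ n, x ∈ f.sublevel R n := by
    rw [h.filledJulia_eq] at hx; exact mem_iInter.1 hx
  have hle : ∀ n, closure (connectedComponentIn (f.sublevel R (n + 1)) x) ⊆
      connectedComponentIn (f.sublevel R n) x := fun n =>
    isPreconnected_connectedComponentIn.closure.subset_connectedComponentIn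
      (subset_closure (mem_connectedComponentIn (hxn _)))
      ((closure_mono (connectedComponentIn_subset _ _)).trans (h.closure_sublevel_subset n))
  have heq : ⋂ n, connectedComponentIn (f.sublevel R n) x =
      ⋂ n, closure (connectedComponentIn (f.sublevel R n) x) := by
    refine (iInter_mono fun n => subset_closure).antisymm ?_
    exact subset_iInter fun n => (iInter_subset _ (n + 1)).trans (hle n)
  refine (subset_iInter fun n => ?_).antisymm ?_
  · refine connectedComponentIn_mono _ ?_
    rw [h.filledJulia_eq]; exact iInter_subset _ n
  · refine IsPreconnected.subset_connectedComponentIn ?_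
      (mem_iInter.2 fun n => mem_connectedComponentIn (hxn n)) ?_
    · rw [heq]
      refine isPreconnected_iInter_of_antitone _ ?_ ?_ ?_
      · exact fun a b hab => closure_mono (connectedComponentIn_mono _ (h.antitone_sublevel hab))
      · exact fun n => (h.isCompact_closure_sublevel n).of_isClosed_subset isClosed_closure
          (closure_mono (connectedComponentIn_subset _ _))
      · exact fun n => isPreconnected_connectedComponentIn.closure
    · rw [h.filledJulia_eq]
      exact iInter_mono fun n => connectedComponentIn_subset _ _

theorem Polynomial.IsEscapeRadius.closure_component_subset (h : f.IsEscapeRadius R)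
    {x : ℂ} (hx : x ∈ f.filledJulia) (n : ℕ) :
    closure (connectedComponentIn (f.sublevel R (n + 1)) x) ⊆
      connectedComponentIn (f.sublevel R n) x := by
  have hxn : ∀ n, x ∈ f.sublevel R n := by
    rw [h.filledJulia_eq] at hx; exact mem_iInter.1 hx
  exact isPreconnected_connectedComponentIn.closure.subset_connectedComponentIn
      (subset_closure (mem_connectedComponentIn (hxn _)))
      ((closure_mono (connectedComponentIn_subset _ _)).trans (h.closure_sublevel_subset n))

theorem Polynomial.IsEscapeRadius.isCompact_component (h : f.IsEscapeRadius R)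
    {x : ℂ} (hx : x ∈ f.filledJulia) : IsCompact (connectedComponentIn f.filledJulia x) := by
  have : connectedComponentIn f.filledJulia x =
      ⋂ n, closure (connectedComponentIn (f.sublevel R n) x) := by
    rw [h.connectedComponentIn_filledJulia hx]
    refine (iInter_mono fun n => subset_closure).antisymm ?_
    exact subset_iInter fun n => (iInter_subset _ (n + 1)).trans (h.closure_component_subset hx n)
  rw [this]
  exact ((h.isCompact_closure_sublevel 0).of_isClosed_subset isClosed_closure
    (closure_mono (connectedComponentIn_subset _ _))).of_isClosed_subset
    (isClosed_iInter fun n => isClosed_closure) (iInter_subset _ 0)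

theorem Polynomial.IsEscapeRadius.exists_component_subset (h : f.IsEscapeRadius R)
    {x : ℂ} (hx : x ∈ f.filledJulia) {V : Set ℂ} (hV : IsOpen V)
    (hKV : connectedComponentIn f.filledJulia x ⊆ V) :
    ∃ N, ∀ n, N ≤ n → connectedComponentIn (f.sublevel R n) x ⊆ V := by
  have hcl : connectedComponentIn f.filledJulia x =
      ⋂ n, closure (connectedComponentIn (f.sublevel R n) x) := by
    rw [h.connectedComponentIn_filledJulia hx]
    refine (iInter_mono fun n => subset_closure).antisymm ?_
    exact subset_iInter fun n => (iInter_subset _ (n + 1)).trans (h.closure_component_subset hx n)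
  have hanti : Antitone fun n => closure (connectedComponentIn (f.sublevel R n) x) :=
    fun a b hab => closure_mono (connectedComponentIn_mono _ (h.antitone_sublevel hab))
  obtain ⟨N, hN⟩ := exists_subset_nhds_of_isCompact hanti.directed_ge
    (fun n => (h.isCompact_closure_sublevel n).of_isClosed_subset isClosed_closure
          (closure_mono (connectedComponentIn_subset _ _)))
    (U := V) (fun y hy => hV.mem_nhds (hKV (hcl ▸ hy)))
  exact ⟨N, fun n hn => subset_closure.trans ((hanti hn).trans hN)⟩

theorem Polynomial.IsEscapeRadius.image_component_sublevel (h : f.IsEscapeRadius R)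
    (hf : f.natDegree ≠ 0) {x : ℂ} (hx : x ∈ f.filledJulia) (n k : ℕ) :
    (f.iter k).eval '' connectedComponentIn (f.sublevel R (n + k)) x =
      connectedComponentIn (f.sublevel R n) ((f.iter k).eval x) := by
  have hxn : ∀ n, x ∈ f.sublevel R n := by
    rw [h.filledJulia_eq] at hx; exact mem_iInter.1 hx
  rw [← preimage_sublevel]
  refine image_connectedComponentIn_preimage _ ?_ (f.isOpen_sublevel R n) ?_
  · rw [natDegree_iter]; exact pow_ne_zero _ hf
  · have := hxn (n + k)
    rwa [← preimage_sublevel] at this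

theorem Polynomial.IsEscapeRadius.iter_mem_filledJulia (h : f.IsEscapeRadius R) {x : ℂ} (k : ℕ) :
    (f.iter k).eval x ∈ f.filledJulia ↔ x ∈ f.filledJulia := by
  have key : ∀ n, (f.iter k).eval x ∈ f.sublevel R n ↔ x ∈ f.sublevel R (n + k) := fun n => by
    rw [← preimage_sublevel]; rfl
  rw [h.filledJulia_eq]
  simp only [mem_iInter, key]
  exact ⟨fun H n => h.antitone_sublevel (Nat.le_add_right n k) (H n), fun H n => H _⟩

theorem Polynomial.IsEscapeRadius.image_component (h : f.IsEscapeRadius R)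
    (hf : f.natDegree ≠ 0) {x : ℂ} (hx : x ∈ f.filledJulia) (k : ℕ) :
    (f.iter k).eval '' connectedComponentIn f.filledJulia x =
      connectedComponentIn f.filledJulia ((f.iter k).eval x) := by
  have hx' := (h.iter_mem_filledJulia k).2 hx
  rw [h.connectedComponentIn_filledJulia hx']
  refine Subset.antisymm ?_ ?_
  · refine subset_iInter fun n => ?_
    rw [← h.image_component_sublevel hf hx]
    refine image_mono ?_
    rw [h.connectedComponentIn_filledJulia hx]
    exact iInter_subset _ _
  · intro w hw
    have hne := IsCompact.nonempty_iInter_of_sequence_nonempty_isCompact_isClosed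
      (fun n => closure (connectedComponentIn (f.sublevel R (n + 1 + k)) x) ∩
        (f.iter k).eval ⁻¹' {w}) ?_ ?_ ?_ ?_
    · obtain ⟨z, hz⟩ := hne
      have hz' := fun n => mem_iInter.1 hz n
      refine ⟨z, ?_, (hz' 0).2⟩
      rw [h.connectedComponentIn_filledJulia hx]
      refine mem_iInter.2 fun n => ?_
      have h1 := h.closure_component_subset hx (n + k) (by
        have := (hz' n).1
        rwa [add_right_comm] at this)
      exact connectedComponentIn_mono _ (h.antitone_sublevel (Nat.le_add_right n k)) h1
    · intro n
      refine inter_subset_inter_left _ (closure_mono (connectedComponentIn_mono _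
        (h.antitone_sublevel (by omega))))
    · intro n
      have := mem_iInter.1 hw (n + 1)
      rw [← h.image_component_sublevel hf hx] at this
      obtain ⟨z, hz, rfl⟩ := this
      exact ⟨z, subset_closure hz, rfl⟩
    · exact ((h.isCompact_closure_sublevel _).of_isClosed_subset isClosed_closure
          (closure_mono (connectedComponentIn_subset _ _))).inter_right
          (isClosed_singleton.preimage (f.iter k).continuous)
    · exact fun n => isClosed_closure.inter (isClosed_singleton.preimage (f.iter k).continuous)

end Escape

/-! ### Unramified proper polynomial maps between open sets -/

/-- `q` restricts to a proper map `U' → U` of open sets without critical points. -/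
structure Polynomial.IsUnramifiedOn (q : ℂ[X]) (U' U : Set ℂ) : Prop where
  natDegree_ne : q.natDegree ≠ 0
  isOpen_source : IsOpen U'
  isOpen_target : IsOpen U
  mapsTo : ∀ z ∈ U', q.eval z ∈ U
  closure_inter : closure U' ∩ q.eval ⁻¹' U ⊆ U'
  deriv_ne : ∀ z ∈ U', q.derivative.eval z ≠ 0

/-- `σ` is a continuous section of `q : U' → ℂ` over the set `C`. -/
def Polynomial.IsSectionOn (q : ℂ[X]) (U' C : Set ℂ) (σ : ℂ → ℂ) : Prop :=
  ContinuousOn σ C ∧ ∀ w ∈ C, σ w ∈ U' ∧ q.eval (σ w) = w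

theorem Polynomial.IsSectionOn.mono {q : ℂ[X]} {U' C C' : Set ℂ} {σ : ℂ → ℂ}
    (h : q.IsSectionOn U' C σ) (hC : C' ⊆ C) : q.IsSectionOn U' C' σ :=
  ⟨h.1.mono hC, fun w hw => h.2 w (hC hw)⟩

/-- The fibre of `q : U' → ℂ` over `w`. -/
def Polynomial.fiberIn (q : ℂ[X]) (U' : Set ℂ) (w : ℂ) : Set ℂ := {z | z ∈ U' ∧ q.eval z = w}

theorem Polynomial.finite_preimage_singleton (q : ℂ[X]) (hq : q.natDegree ≠ 0) (w : ℂ) :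
    (q.eval ⁻¹' {w}).Finite := by
  have : q ≠ C w := fun h => hq (by rw [h]; exact natDegree_C w)
  rw [preimage_eval_singleton this]
  exact rootSet_finite _ _

namespace Polynomial.IsUnramifiedOn

variable {q : ℂ[X]} {U' U : Set ℂ}

theorem finite_fiberIn (h : q.IsUnramifiedOn U' U) (w : ℂ) : (q.fiberIn U' w).Finite :=
  (q.finite_preimage_singleton h.natDegree_ne w).subset fun _ hz => hz.2

theorem isCoveringMap (h : q.IsUnramifiedOn U' U) :
    IsCoveringMap (fun z : U' => (⟨q.eval z, h.mapsTo z z.2⟩ : U)) := by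
  have hcont : Continuous (fun z : U' => (⟨q.eval z, h.mapsTo z z.2⟩ : U)) :=
    (q.continuous.comp continuous_subtype_val).subtype_mk _
  have hloc : IsLocalHomeomorph (fun z : U' => (⟨q.eval z, h.mapsTo z z.2⟩ : U)) := by
    refine IsLocalHomeomorph.of_comp (g := (Subtype.val : U → ℂ)) ?_
      h.isOpen_target.isOpenEmbedding_subtypeVal.isLocalHomeomorph hcont
    have h1 : IsLocalHomeomorphOn q.eval U' := fun x hx =>
      ⟨_, ((q.hasStrictDerivAt x).hasStrictFDerivAt_equiv
        (h.deriv_ne x hx)).mem_toOpenPartialHomeomorph_source, by simp⟩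
    have h2 : IsLocalHomeomorph (Subtype.val : U' → ℂ) :=
      h.isOpen_source.isOpenEmbedding_subtypeVal.isLocalHomeomorph
    exact isLocalHomeomorph_iff_isLocalHomeomorphOn_univ.2
      (h1.comp h2.isLocalHomeomorphOn fun x _ => x.2)
  have hclosed : IsClosedMap (fun z : U' => (⟨q.eval z, h.mapsTo z z.2⟩ : U)) := by
    intro S hS
    obtain ⟨T, hT, rfl⟩ := isClosed_induced_iff.1 hS
    refine isClosed_induced_iff.2 ⟨q.eval '' (T ∩ closure U'),
      q.isClosedMap_eval _ (hT.inter isClosed_closure), ?_⟩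
    ext ⟨w, hw⟩
    constructor
    · rintro ⟨z, ⟨hzT, hz⟩, hzw⟩
      have hzU : z ∈ U' := h.closure_inter ⟨hz, by
        simp only [mem_preimage]; simp only at hzw; rwa [hzw]⟩
      exact ⟨⟨z, hzU⟩, hzT, Subtype.ext hzw⟩
    · rintro ⟨z, hz, hzw⟩
      exact ⟨z, ⟨hz, subset_closure z.2⟩, congrArg Subtype.val hzw⟩
  rw [isCoveringMap_iff_isCoveringMapOn_univ]
  refine hclosed.isCoveringMapOn_of_isLocalHomeomorphOn (fun w _ => ?_)
    hloc.isLocalHomeomorphOn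
  refine Finite.of_finite_image (f := Subtype.val) ?_ Subtype.val_injective.injOn
  refine (h.finite_fiberIn w).subset ?_
  rintro _ ⟨z, hz, rfl⟩
  exact ⟨z.2, congrArg Subtype.val hz⟩

theorem exists_section (h : q.IsUnramifiedOn U' U) {C : Set ℂ} (hC : Convex ℝ C) (hCU : C ⊆ U)
    {z : ℂ} (hz : z ∈ U') (hzC : q.eval z ∈ C) :
    ∃ σ, q.IsSectionOn U' C σ ∧ σ (q.eval z) = z := by
  classical
  have : LocallyPathConnectedSpace C := hC.locallyPathConnectedSpace
  have : ContractibleSpace C := hC.contractibleSpace ⟨_, hzC⟩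
  have : SimplyConnectedSpace C := SimplyConnectedSpace.ofContractible C
  obtain ⟨s, ⟨hs1, hs2⟩, -⟩ := h.isCoveringMap.existsUnique_continuousMap_lifts
    (A := C) ⟨fun w => ⟨w, hCU w.2⟩, by fun_prop⟩ ⟨q.eval z, hzC⟩ ⟨z, hz⟩ rfl
  refine ⟨fun w => if hw : w ∈ C then (s ⟨w, hw⟩ : ℂ) else 0, ⟨?_, ?_⟩, ?_⟩
  · rw [continuousOn_iff_continuous_domRestrict]
    refine (continuous_subtype_val.comp s.continuous).congr fun w => ?_
    simp
  · intro w hw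
    simp only [hw, dif_pos]
    refine ⟨(s ⟨w, hw⟩).2, ?_⟩
    exact congrArg Subtype.val (congrFun hs2 ⟨w, hw⟩)
  · simp [hzC, hs1]

theorem section_eqOn (h : q.IsUnramifiedOn U' U) {C : Set ℂ} (hC : IsPreconnected C)
    {σ τ : ℂ → ℂ} (hσ : q.IsSectionOn U' C σ) (hτ : q.IsSectionOn U' C τ) {v : ℂ} (hv : v ∈ C)
    (heq : σ v = τ v) : EqOn σ τ C := by
  have : PreconnectedSpace C := Subtype.preconnectedSpace hC
  have h1 := h.isCoveringMap.eq_of_comp_eq (A := C)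
    (g₁ := fun w => ⟨σ w, (hσ.2 w w.2).1⟩) (g₂ := fun w => ⟨τ w, (hτ.2 w w.2).1⟩)
    ((continuousOn_iff_continuous_domRestrict.1 hσ.1).subtype_mk _)
    ((continuousOn_iff_continuous_domRestrict.1 hτ.1).subtype_mk _)
    (by ext w; simp [(hσ.2 w w.2).2, (hτ.2 w w.2).2]) ⟨v, hv⟩ (Subtype.ext heq)
  intro w hw
  exact congrArg Subtype.val (congrFun h1 ⟨w, hw⟩)

theorem ncard_fiberIn_le (h : q.IsUnramifiedOn U' U) {C : Set ℂ} (hC : Convex ℝ C)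
    (hCU : C ⊆ U) {v w : ℂ} (hv : v ∈ C) (hw : w ∈ C) :
    (q.fiberIn U' v).ncard ≤ (q.fiberIn U' w).ncard := by
  have hex : ∀ z, z ∈ q.fiberIn U' v → ∃ σ, q.IsSectionOn U' C σ ∧ σ v = z := by
    rintro z ⟨hz, rfl⟩
    exact h.exists_section hC hCU hz hv
  choose! s hs1 hs2 using hex
  refine Set.ncard_le_ncard_of_injOn (fun z => s z w) (fun z hz => (hs1 z hz).2 w hw) ?_
    (h.finite_fiberIn w)
  intro z hz z' hz' heq
  have := h.section_eqOn hC.isPreconnected (hs1 z hz) (hs1 z' hz') hw heq hv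
  rwa [hs2 z hz, hs2 z' hz'] at this

theorem ncard_fiberIn_eq (h : q.IsUnramifiedOn U' U) (hU : IsPreconnected U) {v w : ℂ}
    (hv : v ∈ U) (hw : w ∈ U) : (q.fiberIn U' v).ncard = (q.fiberIn U' w).ncard := by
  refine hU.constant (f := fun w => (q.fiberIn U' w).ncard) ?_ hv hw
  intro x hx
  obtain ⟨r, hr, hball⟩ := Metric.isOpen_iff.1 h.isOpen_target x hx
  have hconv := convex_ball x r
  refine ContinuousAt.continuousWithinAt ?_
  refine (continuousAt_const (y := (q.fiberIn U' x).ncard)).congr ?_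
  filter_upwards [Metric.ball_mem_nhds x hr] with y hy
  exact (h.ncard_fiberIn_le hconv hball (Metric.mem_ball_self hr) hy).antisymm
    (h.ncard_fiberIn_le hconv hball hy (Metric.mem_ball_self hr))

/-- Transport in the fibres of `q : U' → U` along the segment from `v` to `w`. -/
theorem exists_transport (h : q.IsUnramifiedOn U' U) :
    ∃ T : ℂ → ℂ → ℂ → ℂ, ∀ C : Set ℂ, Convex ℝ C → C ⊆ U → ∀ σ, q.IsSectionOn U' C σ →
      ∀ v ∈ C, ∀ w ∈ C, T v w (σ v) = σ w := by
  have hex : ∀ v w z, ∃ y, ∀ C : Set ℂ, Convex ℝ C → C ⊆ U → ∀ σ, q.IsSectionOn U' C σ →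
      v ∈ C → w ∈ C → z = σ v → y = σ w := by
    intro v w z
    by_cases hs : segment ℝ v w ⊆ U ∧ z ∈ U' ∧ q.eval z = v
    · obtain ⟨hs, hz, rfl⟩ := hs
      obtain ⟨τ, hτ, hτz⟩ := h.exists_section (convex_segment _ _) hs hz (left_mem_segment ℝ _ _)
      refine ⟨τ w, fun C hC hCU σ hσ hv hw hzσ => ?_⟩
      exact h.section_eqOn (convex_segment (q.eval z) w).isPreconnected hτ
        (hσ.mono (hC.segment_subset hv hw)) (left_mem_segment ℝ _ _) (by rw [hτz, ← hzσ])
        (right_mem_segment ℝ _ _)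
    · refine ⟨0, fun C hC hCU σ hσ hv hw hzσ => absurd ?_ hs⟩
      refine ⟨(hC.segment_subset hv hw).trans hCU, ?_⟩
      rw [hzσ]
      exact hσ.2 v hv
  choose T hT using hex
  exact ⟨T, fun C hC hCU σ hσ v hv w hw => hT v w _ C hC hCU σ hσ hv hw rfl⟩

end Polynomial.IsUnramifiedOn

/-! ### Finite square complexes in the plane

A finite set `X` of lattice points stands for the union of the unit squares having these points as
lower left corners. Horizontal and vertical edges are indexed by their left, respectively lower,
end points. -/

namespace SquareComplex

open scoped Classical in
/-- Horizontal edges of a square complex. -/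
noncomputable def hEdges (X : Finset (ℤ × ℤ)) : Finset (ℤ × ℤ) :=
  X ∪ X.image (· + (0, 1))

open scoped Classical in
/-- Vertical edges of a square complex. -/
noncomputable def vEdges (X : Finset (ℤ × ℤ)) : Finset (ℤ × ℤ) :=
  X ∪ X.image (· + (1, 0))

open scoped Classical in
/-- Vertices of a square complex. -/
noncomputable def vertices (X : Finset (ℤ × ℤ)) : Finset (ℤ × ℤ) :=
  hEdges X ∪ (hEdges X).image (· + (1, 0))

variable {X : Finset (ℤ × ℤ)}

theorem mem_hEdges {v : ℤ × ℤ} : v ∈ hEdges X ↔ v ∈ X ∨ v - (0, 1) ∈ X := by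
  simp [hEdges, sub_eq_add_neg]

theorem mem_vEdges {v : ℤ × ℤ} : v ∈ vEdges X ↔ v ∈ X ∨ v - (1, 0) ∈ X := by
  simp [vEdges, sub_eq_add_neg]

theorem mem_vertices {v : ℤ × ℤ} : v ∈ vertices X ↔ v ∈ hEdges X ∨ v - (1, 0) ∈ hEdges X := by
  simp [vertices, sub_eq_add_neg]

theorem left_mem_vertices {v : ℤ × ℤ} (h : v ∈ hEdges X) : v ∈ vertices X :=
  mem_vertices.2 (Or.inl h)

theorem right_mem_vertices {v : ℤ × ℤ} (h : v ∈ hEdges X) : v + (1, 0) ∈ vertices X :=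
  mem_vertices.2 (Or.inr (by simpa using h))

theorem lower_mem_vertices {v : ℤ × ℤ} (h : v ∈ vEdges X) : v ∈ vertices X := by
  simp only [mem_vertices, mem_vEdges, mem_hEdges] at *
  tauto

theorem upper_mem_vertices {v : ℤ × ℤ} (h : v ∈ vEdges X) : v + (0, 1) ∈ vertices X := by
  simp only [mem_vertices, mem_vEdges, mem_hEdges] at *
  have : v + (0, 1) - (1, 0) - (0, 1) = v - (1, 0) := by ring
  simp only [add_sub_cancel_right, this]
  tauto

section Extension

variable {M : Type*} [AddCommGroup M] [Module ℚ M]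

open scoped Classical in
/-- Extension by zero of a function on a finite set of lattice points. -/
noncomputable def extend (S : Finset (ℤ × ℤ)) : (S → M) →ₗ[ℚ] (ℤ × ℤ → M) where
  toFun a v := if h : v ∈ S then a ⟨v, h⟩ else 0
  map_add' a b := by ext v; by_cases h : v ∈ S <;> simp [h]
  map_smul' r a := by ext v; by_cases h : v ∈ S <;> simp [h]

theorem extend_of_mem {S : Finset (ℤ × ℤ)} (a : S → M) {v : ℤ × ℤ} (h : v ∈ S) :
    extend S a v = a ⟨v, h⟩ := by
  simp [extend, h]

theorem extend_of_notMem {S : Finset (ℤ × ℤ)} (a : S → M) {v : ℤ × ℤ} (h : v ∉ S) :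
    extend S a v = 0 := by
  simp [extend, h]

theorem sum_extend_sub (S V : Finset (ℤ × ℤ)) (t : ℤ × ℤ) (hV : ∀ e ∈ S, e + t ∈ V)
    (a : S → M) : ∑ v ∈ V, extend S a (v - t) = ∑ e ∈ S, extend S a e := by
  classical
  rw [← Finset.sum_subset (s₁ := S.image (· + t))]
  · rw [Finset.sum_image (fun x _ y _ h => by simpa using h)]
    simp
  · intro v hv
    obtain ⟨e, he, rfl⟩ := Finset.mem_image.1 hv
    exact hV e he
  · intro v _ hv
    refine extend_of_notMem a fun h => hv ?_
    exact Finset.mem_image.2 ⟨v - t, h, by simp⟩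

/-- The twisted coboundary from vertices to edges. -/
noncomputable def coboundary₀ (X : Finset (ℤ × ℤ)) (σh σv : ℤ × ℤ → M →ₗ[ℚ] M) :
    (vertices X → M) →ₗ[ℚ] (hEdges X → M) × (vEdges X → M) where
  toFun φ := (fun e => extend _ φ (e.1 + (1, 0)) - σh e (extend _ φ e),
    fun e => extend _ φ (e.1 + (0, 1)) - σv e (extend _ φ e))
  map_add' a b := by ext v <;> simp <;> abel
  map_smul' r a := by ext v <;> simp [smul_sub]

/-- The twisted coboundary from edges to squares. -/
noncomputable def coboundary₁ (X : Finset (ℤ × ℤ)) (σh σv : ℤ × ℤ → M →ₗ[ℚ] M) :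
    (hEdges X → M) × (vEdges X → M) →ₗ[ℚ] (X → M) where
  toFun z s := σv (s.1 + (1, 0)) (extend _ z.1 s) + extend _ z.2 (s.1 + (1, 0))
    - σh (s.1 + (0, 1)) (extend _ z.2 s) - extend _ z.1 (s.1 + (0, 1))
  map_add' a b := by ext v; simp; abel
  map_smul' r a := by ext v; simp [smul_sub]

theorem coboundary₁_surjective (X : Finset (ℤ × ℤ)) (σh σv : ℤ × ℤ → M →ₗ[ℚ] M) :
    Function.Surjective (coboundary₁ X σh σv) := by
  intro c
  obtain ⟨A, hA⟩ : ∃ A : ℤ, ∀ s ∈ X, A ≤ s.1 := by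
    obtain ⟨A, hA⟩ := (X.image Prod.fst).bddBelow
    exact ⟨A, fun s hs => hA (by simpa using ⟨s.2, hs⟩)⟩
  let B : ℤ → ℕ → M := fun j n => Nat.rec (motive := fun _ => M) 0
    (fun k b => σh (A + k, j + 1) b + extend X c (A + k, j)) n
  let b : ℤ × ℤ → M := fun v => B v.2 (v.1 - A).toNat
  have hb : ∀ s ∈ X, b (s + (1, 0)) = σh (s + (0, 1)) (b s) + extend X c s := by
    rintro ⟨i, j⟩ hs
    have h1 := hA _ hs
    simp only at h1
    obtain ⟨k, rfl⟩ := Int.le.dest h1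
    have h2 : (A + k + 1 - A).toNat = k + 1 := by omega
    have h3 : (A + k - A).toNat = k := by omega
    simp only [b, Prod.mk_add_mk, add_zero, h2, h3]
    rfl
  refine ⟨(0, fun e => b e), ?_⟩
  ext ⟨s, hs⟩
  have e1 : s ∈ vEdges X := mem_vEdges.2 (Or.inl hs)
  have e2 : s + (1, 0) ∈ vEdges X := mem_vEdges.2 (Or.inr (by simpa using hs))
  simp only [coboundary₁, LinearMap.coe_mk, AddHom.coe_mk, map_zero, Pi.zero_apply,
    extend_of_mem _ e1, extend_of_mem _ e2, hb s hs, extend_of_mem _ hs]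
  abel

theorem coboundary₁_comp_coboundary₀ (X : Finset (ℤ × ℤ)) (σh σv : ℤ × ℤ → M →ₗ[ℚ] M)
    (hσ : ∀ s ∈ X, ∀ x, σv (s + (1, 0)) (σh s x) = σh (s + (0, 1)) (σv s x))
    (φ : vertices X → M) : coboundary₁ X σh σv (coboundary₀ X σh σv φ) = 0 := by
  ext ⟨s, hs⟩
  have e1 : s ∈ vEdges X := mem_vEdges.2 (Or.inl hs)
  have e2 : s + (1, 0) ∈ vEdges X := mem_vEdges.2 (Or.inr (by simpa using hs))
  have e3 : s ∈ hEdges X := mem_hEdges.2 (Or.inl hs)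
  have e4 : s + (0, 1) ∈ hEdges X := mem_hEdges.2 (Or.inr (by simpa using hs))
  simp only [coboundary₁, coboundary₀, LinearMap.coe_mk, AddHom.coe_mk, extend_of_mem _ e1,
    extend_of_mem _ e2, extend_of_mem _ e3, extend_of_mem _ e4, map_sub, hσ s hs]
  rw [add_right_comm s (0, 1) (1, 0)]
  simp

/-- The twisted Euler characteristic bounds the dimension of the space of flat sections. -/
theorem card_le_finrank_ker_coboundary₀ [FiniteDimensional ℚ M] (X : Finset (ℤ × ℤ))
    (σh σv : ℤ × ℤ → M →ₗ[ℚ] M)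
    (hσ : ∀ s ∈ X, ∀ x, σv (s + (1, 0)) (σh s x) = σh (s + (0, 1)) (σv s x)) :
    ((vertices X).card + X.card) * Module.finrank ℚ M ≤
      Module.finrank ℚ (coboundary₀ X σh σv).ker +
        ((hEdges X).card + (vEdges X).card) * Module.finrank ℚ M := by
  have h0 := (coboundary₀ X σh σv).finrank_range_add_finrank_ker
  have h1 := (coboundary₁ X σh σv).finrank_range_add_finrank_ker
  rw [LinearMap.range_eq_top.2 (coboundary₁_surjective X σh σv), finrank_top] at h1
  have h2 : (coboundary₀ X σh σv).range ≤ (coboundary₁ X σh σv).ker := by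
    rintro _ ⟨φ, rfl⟩
    exact coboundary₁_comp_coboundary₀ X σh σv hσ φ
  have h3 := Submodule.finrank_mono h2
  simp only [Module.finrank_prod, Module.finrank_pi_fintype, Finset.sum_const, Finset.card_univ,
    Fintype.card_coe, smul_eq_mul] at h0 h1
  linarith

end Extension

/-- Two squares sharing an edge. -/
def Adj (a b : ℤ × ℤ) : Prop :=
  b = a + (1, 0) ∨ a = b + (1, 0) ∨ b = a + (0, 1) ∨ a = b + (0, 1)

/-- A lattice point outside the box `[A, B] × [A, B]`. -/
def Far (A B : ℤ) (s : ℤ × ℤ) : Prop := s.1 < A ∨ B < s.1 ∨ s.2 < A ∨ B < s.2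

/-- The untwisted boundary from edges to vertices. -/
noncomputable def boundary (X : Finset (ℤ × ℤ)) :
    (hEdges X → ℚ) × (vEdges X → ℚ) →ₗ[ℚ] (vertices X → ℚ) where
  toFun z v := extend _ z.1 (v.1 - (1, 0)) - extend _ z.1 v
    + (extend _ z.2 (v.1 - (0, 1)) - extend _ z.2 v)
  map_add' a b := by ext v; simp; abel
  map_smul' r a := by ext v; simp; ring

theorem finrank_range_boundary_lt (hX : X.Nonempty) :
    Module.finrank ℚ (boundary X).range < (vertices X).card := by
  have hne : (boundary X).range ≠ ⊤ := by
    intro htop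
    obtain ⟨s, hs⟩ := hX
    have hsV : s ∈ vertices X := left_mem_vertices (mem_hEdges.2 (Or.inl hs))
    obtain ⟨z, hz⟩ := LinearMap.range_eq_top.1 htop (Pi.single ⟨s, hsV⟩ 1)
    have h1 : ∑ v : vertices X, boundary X z v = 1 := by
      rw [hz]; simp
    have h2 : ∑ v : vertices X, boundary X z v = 0 := by
      simp only [boundary, LinearMap.coe_mk, AddHom.coe_mk]
      rw [Finset.sum_coe_sort (vertices X) (fun v => extend _ z.1 (v - (1, 0)) - extend _ z.1 v
        + (extend _ z.2 (v - (0, 1)) - extend _ z.2 v))]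
      simp only [Finset.sum_add_distrib, Finset.sum_sub_distrib]
      have e1 := sum_extend_sub (hEdges X) (vertices X) (1, 0)
        (fun e he => right_mem_vertices he) z.1
      have e2 := sum_extend_sub (hEdges X) (vertices X) 0
        (fun e he => by simpa using left_mem_vertices he) z.1
      have e3 := sum_extend_sub (vEdges X) (vertices X) (0, 1)
        (fun e he => upper_mem_vertices he) z.2
      have e4 := sum_extend_sub (vEdges X) (vertices X) 0
        (fun e he => by simpa using lower_mem_vertices he) z.2
      simp only [sub_zero] at e2 e4
      rw [e1, e2, e3, e4]
      simp
    rw [h1] at h2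
    exact one_ne_zero h2
  have := Submodule.finrank_lt hne
  simpa using this

/-- The complement of `X` is connected to infinity through squares outside `X`. -/
def IsFilled (X : Finset (ℤ × ℤ)) (A B : ℤ) : Prop :=
  ∀ s ∉ X, ∃ t, Far A B t ∧ Relation.ReflTransGen (fun a b => Adj a b ∧ a ∉ X ∧ b ∉ X) t s

theorem boundary_eq_zero_everywhere {z : (hEdges X → ℚ) × (vEdges X → ℚ)}
    (hz : boundary X z = 0) (v : ℤ × ℤ) :
    extend _ z.1 (v - (1, 0)) - extend _ z.1 v
      + (extend _ z.2 (v - (0, 1)) - extend _ z.2 v) = 0 := by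
  by_cases hv : v ∈ vertices X
  · exact congrFun hz ⟨v, hv⟩
  · rw [extend_of_notMem, extend_of_notMem, extend_of_notMem, extend_of_notMem]
    · simp
    · exact fun h => hv (lower_mem_vertices h)
    · exact fun h => hv (by simpa using upper_mem_vertices h)
    · exact fun h => hv (left_mem_vertices h)
    · exact fun h => hv (by simpa using right_mem_vertices h)

/-- A one-cycle of a square complex is the boundary of a two-chain on the whole lattice. -/
theorem exists_potential {A B : ℤ} (hbox : ∀ s ∈ X, A ≤ s.1 ∧ s.1 ≤ B ∧ A ≤ s.2 ∧ s.2 ≤ B) :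
    ∃ c : (hEdges X → ℚ) × (vEdges X → ℚ) →ₗ[ℚ] (ℤ × ℤ → ℚ), ∀ z, boundary X z = 0 →
      (∀ s, c z (s + (1, 0)) - c z s = extend _ z.2 (s + (1, 0))) ∧
      (∀ s, c z (s + (0, 1)) - c z s = - extend _ z.1 (s + (0, 1))) ∧
      ∀ s, Far A B s → c z s = 0 := by
  let c : (hEdges X → ℚ) × (vEdges X → ℚ) →ₗ[ℚ] (ℤ × ℤ → ℚ) :=
    { toFun := fun z s => ∑ k ∈ Finset.range (s.1 + 1 - A).toNat, extend _ z.2 (A + k, s.2)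
      map_add' := fun a b => by ext v; simp [Finset.sum_add_distrib]
      map_smul' := fun r a => by ext v; simp [Finset.mul_sum] }
  have hc : ∀ z s, c z s =
    ∑ k ∈ Finset.range (s.1 + 1 - A).toNat, extend _ z.2 (A + k, s.2) := fun _ _ => rfl
  have hhbox : ∀ s ∈ hEdges X, A ≤ s.1 ∧ s.1 ≤ B ∧ A ≤ s.2 ∧ s.2 ≤ B + 1 := by
    rintro ⟨i, j⟩ hs
    rcases mem_hEdges.1 hs with h | h <;> have := hbox _ h <;> simp at this ⊢ <;> omega
  have hvbox : ∀ s ∈ vEdges X, A ≤ s.1 ∧ s.1 ≤ B + 1 ∧ A ≤ s.2 ∧ s.2 ≤ B := by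
    rintro ⟨i, j⟩ hs
    rcases mem_vEdges.1 hs with h | h <;> have := hbox _ h <;> simp at this ⊢ <;> omega
  have hleft : ∀ z i j, i < A → c z (i, j) = 0 := by
    intro z i j hi
    rw [hc]
    have : (i + 1 - A).toNat = 0 := by omega
    simp [this]
  have hstep : ∀ z, ∀ i j, c z (i + 1, j) - c z (i, j) = extend _ z.2 (i + 1, j) := by
    intro z i j
    by_cases hi : i + 1 < A
    · rw [hleft z _ _ hi, hleft z i j (by omega), extend_of_notMem]
      · simp
      · intro h
        have := (hvbox _ h).1
        simp at this
        omega
    · obtain ⟨k, hk⟩ := Int.le.dest (not_lt.1 hi)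
      have e1 : (i + 1 + 1 - A).toNat = k + 1 := by omega
      have e2 : (i + 1 - A).toNat = k := by omega
      rw [hc, hc]
      simp only [e1, e2, Finset.sum_range_succ, hk]
      ring
  have hvert : ∀ z, boundary X z = 0 → ∀ i j,
      c z (i, j + 1) - c z (i, j) = - extend _ z.1 (i, j + 1) := by
    intro z hz i j
    by_cases hi : i < A
    · rw [hleft z _ _ hi, hleft z _ _ hi, extend_of_notMem]
      · simp
      · intro h
        have := (hhbox _ h).1
        simp at this
        omega
    · obtain ⟨k, rfl⟩ := Int.le.dest (not_lt.1 hi)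
      have hb : ∀ i, extend _ z.1 (i, j + 1) - extend _ z.1 (i + 1, j + 1)
          + (extend _ z.2 (i + 1, j) - extend _ z.2 (i + 1, j + 1)) = 0 := fun i => by
        have := boundary_eq_zero_everywhere hz (i + 1, j + 1)
        simpa only [Prod.mk_sub_mk, add_sub_cancel_right, sub_zero] using this
      clear hi
      induction k with
      | zero =>
        have h1 := hstep z (A - 1) (j + 1)
        have h2 := hstep z (A - 1) j
        have h3 := hb (A - 1)
        rw [hleft z (A - 1) _ (by omega)] at h1 h2
        rw [extend_of_notMem (S := hEdges X) _ (v := (A - 1, j + 1)) (fun h => by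
          have := (hhbox _ h).1
          simp at this)] at h3
        simp only [sub_add_cancel] at h1 h2 h3
        simp only [Nat.cast_zero, add_zero]
        linarith
      | succ k ih =>
        have h1 := hstep z (A + k) (j + 1)
        have h2 := hstep z (A + k) j
        have h3 := hb (A + k)
        push_cast
        rw [← add_assoc]
        linarith
  refine ⟨c, fun z hz => ⟨?_, ?_, ?_⟩⟩
  · rintro ⟨i, j⟩
    simpa using hstep z i j
  · rintro ⟨i, j⟩
    simpa using hvert z hz i j
  · have hlow : ∀ i j, j < A ∨ B < j → c z (i, j) = 0 := by
      intro i j hj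
      rw [hc]
      refine Finset.sum_eq_zero fun k _ => extend_of_notMem _ fun h => ?_
      have := hvbox _ h
      simp at this
      omega
    rintro ⟨i, j⟩ (h | h | h | h)
    · exact hleft z i j h
    · have hi : B < i := h
      by_cases hj : j < A
      · exact hlow i j (Or.inl hj)
      · obtain ⟨k, rfl⟩ := Int.le.dest (not_lt.1 hj)
        clear h hj
        have hv : ∀ j, c z (i, j + 1) - c z (i, j) = 0 := fun j => by
          rw [hvert z hz, extend_of_notMem, neg_zero]
          intro h
          have := hhbox _ h
          simp at this
          omega
        induction k with
        | zero =>
          have := hv (A - 1)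
          rw [hlow i (A - 1) (by omega)] at this
          simpa using this
        | succ k ih =>
          have := hv (A + k)
          push_cast
          rw [← add_assoc]
          linarith
    · exact hlow i j (Or.inl h)
    · exact hlow i j (Or.inr h)

/-- A nonempty filled square complex has Euler characteristic at least one. -/
theorem euler_le (hX : X.Nonempty) {A B : ℤ}
    (hbox : ∀ s ∈ X, A ≤ s.1 ∧ s.1 ≤ B ∧ A ≤ s.2 ∧ s.2 ≤ B) (hfill : IsFilled X A B) :
    (hEdges X).card + (vEdges X).card + 1 ≤ (vertices X).card + X.card := by
  obtain ⟨c, hc⟩ := exists_potential hbox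
  let L : (boundary X).ker →ₗ[ℚ] (X → ℚ) :=
    (LinearMap.funLeft ℚ ℚ (Subtype.val : X → ℤ × ℤ)) ∘ₗ c ∘ₗ (boundary X).ker.subtype
  have hL : Function.Injective L := by
    rw [injective_iff_map_eq_zero]
    rintro ⟨z, hz⟩ hLz
    obtain ⟨h1, h2, h3⟩ := hc z hz
    have h0 : ∀ s, c z s = 0 := by
      intro s
      by_cases hs : s ∈ X
      · exact congrFun hLz ⟨s, hs⟩
      · obtain ⟨t, ht, hts⟩ := hfill s hs
        clear hs
        induction hts with
        | refl => exact h3 _ ht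
        | @tail a b _ hab ih =>
          obtain ⟨hadj, ha, hb⟩ := hab
          rcases hadj with rfl | rfl | rfl | rfl
          · have := h1 a
            rw [ih, extend_of_notMem] at this
            · simpa using this
            · simp only [mem_vEdges, add_sub_cancel_right]; tauto
          · have := h1 b
            rw [ih, extend_of_notMem] at this
            · simpa using this
            · simp only [mem_vEdges, add_sub_cancel_right]; tauto
          · have := h2 a
            rw [ih, extend_of_notMem] at this
            · simpa using this
            · simp only [mem_hEdges, add_sub_cancel_right]; tauto
          · have := h2 b
            rw [ih, extend_of_notMem] at this
            · simpa using this
            · simp only [mem_hEdges, add_sub_cancel_right]; tauto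
    have hz1 : z.1 = 0 := by
      ext ⟨e, he⟩
      have := h2 (e - (0, 1))
      rw [h0, h0, sub_add_cancel, extend_of_mem _ he] at this
      simpa using this.symm
    have hz2 : z.2 = 0 := by
      ext ⟨e, he⟩
      have := h1 (e - (1, 0))
      rw [h0, h0, sub_add_cancel, extend_of_mem _ he] at this
      simpa using this.symm
    exact Subtype.ext (Prod.ext hz1 hz2)
  have h1 := LinearMap.finrank_le_finrank_of_injective hL
  have h2 := (boundary X).finrank_range_add_finrank_ker
  have h3 := finrank_range_boundary_lt hX
  simp only [Module.finrank_prod, Module.finrank_pi_fintype, Module.finrank_self, Finset.sum_const,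
    Finset.card_univ, Fintype.card_coe, smul_eq_mul, mul_one] at h1 h2
  omega

/-- If the flat sections of a rank `D` local system on a nonempty filled square complex are
all constant functions, then `D ≤ 1`. -/
theorem rank_le_one_of_flat_const (hX : X.Nonempty) {A B : ℤ}
    (hbox : ∀ s ∈ X, A ≤ s.1 ∧ s.1 ≤ B ∧ A ≤ s.2 ∧ s.2 ≤ B) (hfill : IsFilled X A B)
    {D : ℕ} (σh σv : ℤ × ℤ → (Fin D → ℚ) →ₗ[ℚ] (Fin D → ℚ))
    (hσ : ∀ s ∈ X, ∀ x, σv (s + (1, 0)) (σh s x) = σh (s + (0, 1)) (σv s x))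
    (hflat : ∀ φ : ℤ × ℤ → Fin D → ℚ, (∀ e ∈ hEdges X, φ (e + (1, 0)) = σh e (φ e)) →
      (∀ e ∈ vEdges X, φ (e + (0, 1)) = σv e (φ e)) →
      ∃ c : ℚ, ∀ v ∈ vertices X, ∀ k, φ v k = c) : D ≤ 1 := by
  rcases Nat.eq_zero_or_pos D with rfl | hD
  · exact Nat.zero_le _
  have h1 := card_le_finrank_ker_coboundary₀ X σh σv hσ
  have h2 := euler_le hX hbox hfill
  obtain ⟨s, hs⟩ := hX
  have hsV : s ∈ vertices X := left_mem_vertices (mem_hEdges.2 (Or.inl hs))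
  let L : (coboundary₀ X σh σv).ker →ₗ[ℚ] ℚ :=
    (LinearMap.proj ⟨0, hD⟩) ∘ₗ (LinearMap.proj ⟨s, hsV⟩) ∘ₗ (coboundary₀ X σh σv).ker.subtype
  have hL : Function.Injective L := by
    rw [injective_iff_map_eq_zero]
    rintro ⟨φ, hφ⟩ hLφ
    have hφ' : coboundary₀ X σh σv φ = 0 := hφ
    obtain ⟨c, hc⟩ := hflat (extend _ φ)
      (fun e he => by
        have := congrFun (congrArg Prod.fst hφ') ⟨e, he⟩
        exact sub_eq_zero.1 this)
      (fun e he => by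
        have := congrFun (congrArg Prod.snd hφ') ⟨e, he⟩
        exact sub_eq_zero.1 this)
    have hc0 : c = 0 := by
      rw [← hc s hsV ⟨0, hD⟩, extend_of_mem _ hsV]
      exact hLφ
    refine Subtype.ext ?_
    ext ⟨v, hv⟩ k
    have := hc v hv k
    rw [extend_of_mem _ hv, hc0] at this
    exact this
  have h3 := LinearMap.finrank_le_finrank_of_injective hL
  simp only [Module.finrank_self, Module.finrank_fintype_fun_eq_card, Fintype.card_fin] at h1 h3
  nlinarith

end SquareComplex

/-! ### Square grids and filled sets of squares -/

namespace SquareComplex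

theorem Adj.symm {a b : ℤ × ℤ} (h : Adj a b) : Adj b a := by
  unfold Adj at *
  tauto

/-- Every finite set of squares can be filled: one adds the squares which cannot be reached from
infinity. -/
theorem exists_filling (X₀ : Finset (ℤ × ℤ)) : ∃ (A B : ℤ) (X : Finset (ℤ × ℤ)), X₀ ⊆ X ∧
    (∀ s ∈ X, A ≤ s.1 ∧ s.1 ≤ B ∧ A ≤ s.2 ∧ s.2 ≤ B) ∧ IsFilled X A B ∧
    ∀ s ∈ X, s ∉ X₀ → ∀ t, Adj s t → t ∈ X := by
  classical
  obtain ⟨A, hA⟩ := (X₀.image Prod.fst ∪ X₀.image Prod.snd).bddBelow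
  obtain ⟨B, hB⟩ := (X₀.image Prod.fst ∪ X₀.image Prod.snd).bddAbove
  have hfar : ∀ s ∈ X₀, ¬ Far A B s := by
    intro s hs h
    have h1 : s.1 ∈ (X₀.image Prod.fst ∪ X₀.image Prod.snd) :=
      Finset.mem_union_left _ (Finset.mem_image_of_mem _ hs)
    have h2 : s.2 ∈ (X₀.image Prod.fst ∪ X₀.image Prod.snd) :=
      Finset.mem_union_right _ (Finset.mem_image_of_mem _ hs)
    have := hA h1
    have := hA h2
    have := hB h1
    have := hB h2
    unfold Far at h
    omega
  let r : ℤ × ℤ → ℤ × ℤ → Prop := fun a b => Adj a b ∧ b ∉ X₀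
  let out : ℤ × ℤ → Prop := fun s => ∃ t, Far A B t ∧ Relation.ReflTransGen r t s
  have hout : ∀ a b, out a → Adj a b → b ∉ X₀ → out b := fun a b ⟨t, ht, hta⟩ hab hb =>
    ⟨t, ht, hta.tail ⟨hab, hb⟩⟩
  have hmem : ∀ s, s ∈ ((Finset.Icc A B ×ˢ Finset.Icc A B).filter fun s => ¬ out s) ↔ ¬ out s := by
    intro s
    simp only [Finset.mem_filter, Finset.mem_product, Finset.mem_Icc, and_iff_right_iff_imp]
    intro hs
    by_contra hbox
    refine hs ⟨s, ?_, .refl⟩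
    unfold Far
    omega
  refine ⟨A, B, (Finset.Icc A B ×ˢ Finset.Icc A B).filter fun s => ¬ out s, ?_, ?_, ?_, ?_⟩
  · intro s hs
    rw [hmem]
    rintro ⟨t, ht, hts⟩
    rcases Relation.ReflTransGen.cases_tail hts with rfl | ⟨b, -, -, hb⟩
    · exact hfar _ hs ht
    · exact hb hs
  · intro s hs
    simp only [Finset.mem_filter, Finset.mem_product, Finset.mem_Icc] at hs
    exact ⟨hs.1.1.1, hs.1.1.2, hs.1.2.1, hs.1.2.2⟩
  · intro s hs
    rw [hmem, not_not] at hs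
    obtain ⟨t, ht, hts⟩ := hs
    refine ⟨t, ht, ?_⟩
    have ht0 : out t := ⟨t, ht, .refl⟩
    have key : out s ∧ Relation.ReflTransGen (fun a b => Adj a b ∧
        a ∉ ((Finset.Icc A B ×ˢ Finset.Icc A B).filter fun s => ¬ out s) ∧
        b ∉ ((Finset.Icc A B ×ˢ Finset.Icc A B).filter fun s => ¬ out s)) t s := by
      induction hts with
      | refl => exact ⟨ht0, .refl⟩
      | @tail a b _ hab ih =>
        have hb := hout a b ih.1 hab.1 hab.2
        refine ⟨hb, ih.2.tail ⟨hab.1, ?_, ?_⟩⟩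
        · rw [hmem, not_not]; exact ih.1
        · rw [hmem, not_not]; exact hb
    exact key.2
  · intro s hs hs0 t hst
    rw [hmem] at hs ⊢
    exact fun ht => hs (hout t s ht hst.symm hs0)

/-- Every square of a filled complex can be moved to the left to a square in the core `X₀`. -/
theorem induction_left {X₀ X : Finset (ℤ × ℤ)} {A : ℤ} (hA : ∀ s ∈ X, A ≤ s.1)
    (hadj : ∀ s ∈ X, s ∉ X₀ → ∀ t, Adj s t → t ∈ X) {p : ℤ × ℤ → Prop}
    (h0 : ∀ s ∈ X₀, p s)
    (hstep : ∀ s, s ∈ X → s + (1, 0) ∈ X → p s → p (s + (1, 0))) : ∀ s ∈ X, p s := by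
  have key : ∀ (k : ℕ) (s : ℤ × ℤ), s ∈ X → s.1 < A + k → p s := by
    intro k
    induction k with
    | zero =>
      intro s hs hk
      have := hA s hs
      simp at hk
      omega
    | succ k ih =>
      intro s hs hk
      by_cases hs0 : s ∈ X₀
      · exact h0 s hs0
      · have ht : s - (1, 0) ∈ X := hadj s hs hs0 _ (Or.inr (Or.inl (by simp)))
        have := hstep (s - (1, 0)) ht (by simpa using hs) (ih _ ht (by
          push_cast at hk
          simp only [Prod.fst_sub]
          omega))
        simpa using this
  intro s hs
  refine key (s.1 - A + 1).toNat s hs ?_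
  have := hA s hs
  omega

/-- The closed square of side `ε` with lower left corner `ε * s`. -/
def square (ε : ℝ) (s : ℤ × ℤ) : Set ℂ :=
  Icc (ε * s.1) (ε * (s.1 + 1)) ×ℂ Icc (ε * s.2) (ε * (s.2 + 1))

/-- The lattice point `ε * s`. -/
def corner (ε : ℝ) (s : ℤ × ℤ) : ℂ := ⟨ε * s.1, ε * s.2⟩

variable {ε : ℝ}

theorem mem_square {s : ℤ × ℤ} {z : ℂ} : z ∈ square ε s ↔
    (ε * s.1 ≤ z.re ∧ z.re ≤ ε * (s.1 + 1)) ∧ (ε * s.2 ≤ z.im ∧ z.im ≤ ε * (s.2 + 1)) := by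
  simp [square, Complex.mem_reProdIm]

theorem isCompact_square (s : ℤ × ℤ) : IsCompact (square ε s) :=
  isCompact_Icc.reProdIm isCompact_Icc

theorem convex_square (s : ℤ × ℤ) : Convex ℝ (square ε s) :=
  ((convex_Icc _ _).linear_preimage Complex.reLm).inter
    ((convex_Icc _ _).linear_preimage Complex.imLm)

theorem corner_mem_square (hε : 0 < ε) {s t : ℤ × ℤ} (h : s.1 ≤ t.1 ∧ t.1 ≤ s.1 + 1 ∧
    s.2 ≤ t.2 ∧ t.2 ≤ s.2 + 1) : corner ε t ∈ square ε s := by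
  obtain ⟨h1, h2, h3, h4⟩ := h
  have h1' : (s.1 : ℝ) ≤ t.1 := by exact_mod_cast h1
  have h2' : (t.1 : ℝ) ≤ s.1 + 1 := by exact_mod_cast h2
  have h3' : (s.2 : ℝ) ≤ t.2 := by exact_mod_cast h3
  have h4' : (t.2 : ℝ) ≤ s.2 + 1 := by exact_mod_cast h4
  rw [mem_square]
  simp only [corner]
  exact ⟨⟨by gcongr, by gcongr⟩, by gcongr, by gcongr⟩

theorem dist_le_of_mem_square {s : ℤ × ℤ} {z w : ℂ} (hz : z ∈ square ε s)
    (hw : w ∈ square ε s) : dist z w ≤ 2 * ε := by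
  rw [mem_square] at hz hw
  rw [dist_eq_norm]
  refine (Complex.norm_le_abs_re_add_abs_im _).trans ?_
  have h1 : |(z - w).re| ≤ ε := by
    rw [Complex.sub_re, abs_le]; constructor <;> linarith [hz.1.1, hz.1.2, hw.1.1, hw.1.2]
  have h2 : |(z - w).im| ≤ ε := by
    rw [Complex.sub_im, abs_le]; constructor <;> linarith [hz.2.1, hz.2.2, hw.2.1, hw.2.2]
  linarith

/-- The square containing a given point obtained by rounding down. -/
noncomputable def floorSquare (ε : ℝ) (z : ℂ) : ℤ × ℤ := (⌊z.re / ε⌋, ⌊z.im / ε⌋)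

theorem mem_square_iff_div (hε : 0 < ε) {s : ℤ × ℤ} {z : ℂ} : z ∈ square ε s ↔
    (s.1 ≤ z.re / ε ∧ z.re / ε ≤ s.1 + 1) ∧ (s.2 ≤ z.im / ε ∧ z.im / ε ≤ s.2 + 1) := by
  rw [mem_square, le_div_iff₀ hε, div_le_iff₀ hε, le_div_iff₀ hε, div_le_iff₀ hε]
  simp only [mul_comm ε]

theorem mem_floorSquare (hε : 0 < ε) (z : ℂ) : z ∈ square ε (floorSquare ε z) := by
  rw [mem_square_iff_div hε]
  exact ⟨⟨Int.floor_le _, (Int.lt_floor_add_one _).le⟩, Int.floor_le _,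
    (Int.lt_floor_add_one _).le⟩

theorem mem_square_floorSquare_nhds (hε : 0 < ε) (z : ℂ) :
    ∀ᶠ w in 𝓝 z, z ∈ square ε (floorSquare ε w) := by
  have key : ∀ x : ℝ, ∀ᶠ y in 𝓝 x, (⌊y⌋ : ℝ) ≤ x ∧ x ≤ ⌊y⌋ + 1 := by
    intro x
    filter_upwards [Ioo_mem_nhds (show (⌈x⌉ : ℝ) - 1 < x by linarith [Int.ceil_lt_add_one x])
      (show x < ⌊x⌋ + 1 from Int.lt_floor_add_one x)] with y hy
    constructor
    · have : ⌊y⌋ < ⌊x⌋ + 1 := by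
        rw [Int.floor_lt]; push_cast; exact hy.2
      have h2 : (⌊y⌋ : ℝ) ≤ ⌊x⌋ := by exact_mod_cast Int.lt_add_one_iff.1 this
      exact h2.trans (Int.floor_le x)
    · have : ⌈x⌉ - 1 ≤ ⌊y⌋ := by
        rw [Int.le_floor]; push_cast; exact hy.1.le
      have h2 : (⌈x⌉ : ℝ) ≤ ⌊y⌋ + 1 := by exact_mod_cast (by omega : ⌈x⌉ ≤ ⌊y⌋ + 1)
      exact (Int.le_ceil x).trans h2
  have h1 : Tendsto (fun w : ℂ => w.re / ε) (𝓝 z) (𝓝 (z.re / ε)) :=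
    (Complex.continuous_re.div_const ε).tendsto z
  have h2 : Tendsto (fun w : ℂ => w.im / ε) (𝓝 z) (𝓝 (z.im / ε)) :=
    (Complex.continuous_im.div_const ε).tendsto z
  filter_upwards [h1.eventually (key _), h2.eventually (key _)] with w hw1 hw2
  rw [mem_square_iff_div hε]
  exact ⟨hw1, hw2⟩

/-- The squares containing a given point that also meet a square of `X` outside the core `X₀`
belong to `X`, unless the point lies in the core. -/
theorem mem_of_mem_square {X₀ X : Finset (ℤ × ℤ)} (hε : 0 < ε)
    (hadj : ∀ s ∈ X, s ∉ X₀ → ∀ t, Adj s t → t ∈ X) {z : ℂ}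
    (hz0 : ∀ s ∈ X₀, z ∉ square ε s) {s t : ℤ × ℤ} (hs : s ∈ X) (hzs : z ∈ square ε s)
    (hzt : z ∈ square ε t) : t ∈ X := by
  rw [mem_square_iff_div hε] at hzs hzt
  obtain ⟨⟨a1, a2⟩, a3, a4⟩ := hzs
  obtain ⟨⟨b1, b2⟩, b3, b4⟩ := hzt
  have hstep : ∀ a b : ℤ × ℤ, a ∈ X → Adj a b → z ∈ square ε a → b ∈ X := by
    intro a b ha hab hza
    exact hadj a ha (fun h => hz0 a h hza) b hab
  have c1 : s.1 ≤ t.1 + 1 := by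
    have : (s.1 : ℝ) ≤ t.1 + 1 := a1.trans b2
    exact_mod_cast this
  have c2 : t.1 ≤ s.1 + 1 := by
    have : (t.1 : ℝ) ≤ s.1 + 1 := b1.trans a2
    exact_mod_cast this
  have c3 : s.2 ≤ t.2 + 1 := by
    have : (s.2 : ℝ) ≤ t.2 + 1 := a3.trans b4
    exact_mod_cast this
  have c4 : t.2 ≤ s.2 + 1 := by
    have : (t.2 : ℝ) ≤ s.2 + 1 := b3.trans a4
    exact_mod_cast this
  have hzs : z ∈ square ε s := (mem_square_iff_div hε).2 ⟨⟨a1, a2⟩, a3, a4⟩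
  have hzm : z ∈ square ε (t.1, s.2) := (mem_square_iff_div hε).2 ⟨⟨b1, b2⟩, a3, a4⟩
  have hm : (t.1, s.2) ∈ X := by
    rcases (by omega : t.1 = s.1 ∨ t.1 = s.1 + 1 ∨ s.1 = t.1 + 1) with h | h | h
    · rwa [h]
    · exact hstep s _ hs (Or.inl (by ext <;> simp [h])) hzs
    · exact hstep s _ hs (Or.inr (Or.inl (by ext <;> simp [h]))) hzs
  rcases (by omega : t.2 = s.2 ∨ t.2 = s.2 + 1 ∨ s.2 = t.2 + 1) with h | h | h
  · rwa [← h] at hm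
  · exact hstep _ t hm (Or.inr (Or.inr (Or.inl (by ext <;> simp [h])))) hzm
  · exact hstep _ t hm (Or.inr (Or.inr (Or.inr (by ext <;> simp [h])))) hzm

/-- The maximum principle for the squares added in a filling. -/
theorem norm_lt_of_mem_filling {X₀ X : Finset (ℤ × ℤ)} (hε : 0 < ε)
    (hadj : ∀ s ∈ X, s ∉ X₀ → ∀ t, Adj s t → t ∈ X) (P : ℂ[X]) {R : ℝ}
    (hP : ∀ s ∈ X₀, ∀ z ∈ square ε s, ‖P.eval z‖ < R) (hX₀ : X₀.Nonempty) :
    ∀ s ∈ X, ∀ z ∈ square ε s, ‖P.eval z‖ < R := by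
  set Y := ⋃ s ∈ X, square ε s with hY
  set Y₀ := ⋃ s ∈ X₀, square ε s with hY₀
  have hYc : IsCompact Y := X.isCompact_biUnion fun s _ => isCompact_square s
  have hY₀c : IsCompact Y₀ := X₀.isCompact_biUnion fun s _ => isCompact_square s
  have hopen : IsOpen (Y \ Y₀) := by
    rw [isOpen_iff_mem_nhds]
    rintro z ⟨hz, hz0⟩
    simp only [hY, mem_iUnion] at hz
    obtain ⟨s, hs, hzs⟩ := hz
    have hz0' : ∀ s ∈ X₀, z ∉ square ε s := fun s hs h => hz0 (mem_biUnion hs h)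
    filter_upwards [mem_square_floorSquare_nhds hε z, hY₀c.isClosed.isOpen_compl.mem_nhds hz0]
      with w hw hw0
    exact ⟨mem_biUnion (mem_of_mem_square hε hadj hz0' hs hzs hw) (mem_floorSquare hε w), hw0⟩
  have hne : Y₀.Nonempty := by
    obtain ⟨s, hs⟩ := hX₀
    exact ⟨corner ε s, mem_biUnion hs (corner_mem_square hε (by omega))⟩
  obtain ⟨z₀, hz₀, hmax⟩ := hY₀c.exists_isMaxOn hne P.continuous.norm.continuousOn
  have hlt : ∀ z ∈ Y₀, ‖P.eval z‖ < R := by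
    intro z hz
    simp only [hY₀, mem_iUnion] at hz
    obtain ⟨s, hs, hz⟩ := hz
    exact hP s hs z hz
  intro s hs z hz
  by_cases hz0 : z ∈ Y₀
  · exact hlt z hz0
  · refine lt_of_le_of_lt ?_ (hlt z₀ hz₀)
    refine Complex.norm_le_of_forall_mem_frontier_norm_le (f := P.eval)
      (hYc.isBounded.subset sdiff_subset) P.differentiable.diffContOnCl ?_
      (subset_closure (show z ∈ Y \ Y₀ from ⟨mem_biUnion hs hz, hz0⟩))
    intro w hw
    rw [hopen.frontier_eq] at hw
    have hwY : w ∈ Y := closure_minimal sdiff_subset hYc.isClosed hw.1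
    have hw0 : w ∈ Y₀ := by
      by_contra h
      exact hw.2 ⟨hwY, h⟩
    exact hmax hw0

/-- Squares of a filling of a core contained in a component of a sublevel set of a polynomial
stay in that component. -/
theorem square_subset_of_mem_filling {X₀ X : Finset (ℤ × ℤ)} {A : ℤ} (hε : 0 < ε)
    (hA : ∀ s ∈ X, A ≤ s.1)
    (hadj : ∀ s ∈ X, s ∉ X₀ → ∀ t, Adj s t → t ∈ X) (P : ℂ[X]) {R : ℝ} {x : ℂ}
    (hP : ∀ s ∈ X₀, square ε s ⊆ connectedComponentIn {z | ‖P.eval z‖ < R} x)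
    (hX₀ : X₀.Nonempty) :
    ∀ s ∈ X, square ε s ⊆ connectedComponentIn {z | ‖P.eval z‖ < R} x := by
  have hlt := norm_lt_of_mem_filling hε hadj P
    (fun s hs z hz => connectedComponentIn_subset {z | ‖P.eval z‖ < R} x (hP s hs hz)) hX₀
  refine induction_left hA hadj hP ?_
  intro s hs hs1 hsub
  have hc1 : corner ε (s + (1, 0)) ∈ square ε s :=
    corner_mem_square hε ⟨by simp, by simp, by simp, by simp⟩
  have hc2 : corner ε (s + (1, 0)) ∈ square ε (s + (1, 0)) :=
    corner_mem_square hε (by omega)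
  rw [connectedComponentIn_eq (hsub hc1)]
  exact (convex_square _).isPreconnected.subset_connectedComponentIn hc2 (hlt _ hs1)

/-- A compact subset of an open set is covered by finitely many small squares which are contained
in the open set. -/
theorem exists_core {K U : Set ℂ} (hK : IsCompact K) (hU : IsOpen U) (hKU : K ⊆ U) :
    ∃ ε : ℝ, 0 < ε ∧ ∃ X₀ : Finset (ℤ × ℤ), (∀ s, (square ε s ∩ K).Nonempty → s ∈ X₀) ∧
      ∀ s ∈ X₀, (square ε s ∩ K).Nonempty ∧ square ε s ⊆ U := by
  classical
  obtain ⟨δ, hδ, hsub⟩ := hK.exists_cthickening_subset_open hU hKU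
  have hε : 0 < δ / 2 := by positivity
  obtain ⟨M, hM⟩ := hK.isBounded.exists_norm_le
  set n : ℤ := ⌈M / (δ / 2)⌉ + 1
  refine ⟨δ / 2, hε, (Finset.Icc (-n) n ×ˢ Finset.Icc (-n) n).filter
    fun s => (square (δ / 2) s ∩ K).Nonempty, ?_, ?_⟩
  · rintro s ⟨z, hz, hzK⟩
    simp only [Finset.mem_filter, Finset.mem_product, Finset.mem_Icc]
    refine ⟨?_, z, hz, hzK⟩
    rw [mem_square_iff_div hε] at hz
    have h1 := (Complex.abs_re_le_norm z).trans (hM z hzK)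
    have h2 := (Complex.abs_im_le_norm z).trans (hM z hzK)
    have h3 : ∀ x : ℝ, |x| ≤ M → ∀ i : ℤ, (i : ℝ) ≤ x / (δ / 2) → x / (δ / 2) ≤ i + 1 →
        -n ≤ i ∧ i ≤ n := by
      intro x hx i hi1 hi2
      have h4 : |x / (δ / 2)| ≤ M / (δ / 2) := by
        rw [abs_div, abs_of_pos hε]; gcongr
      have h5 := Int.le_ceil (M / (δ / 2))
      rw [abs_le] at h4
      constructor
      · have : -(⌈M / (δ / 2)⌉ : ℝ) ≤ i + 1 := by linarith [h4.1]
        have : -⌈M / (δ / 2)⌉ ≤ i + 1 := by exact_mod_cast this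
        omega
      · have : (i : ℝ) ≤ ⌈M / (δ / 2)⌉ := by linarith [h4.2]
        have : i ≤ ⌈M / (δ / 2)⌉ := by exact_mod_cast this
        omega
    exact ⟨h3 _ h1 _ hz.1.1 hz.1.2, h3 _ h2 _ hz.2.1 hz.2.2⟩
  · intro s hs
    obtain ⟨-, z, hz, hzK⟩ := Finset.mem_filter.1 hs
    refine ⟨⟨z, hz, hzK⟩, fun w hw => hsub ?_⟩
    refine Metric.mem_cthickening_of_dist_le w z δ K hzK ?_
    have := dist_le_of_mem_square hw hz
    linarith

end SquareComplex

/-! ### Unramified polynomial maps with a connected preimage have degree one -/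

namespace SquareComplex

variable {q : ℂ[X]} {U' U K : Set ℂ} {ε : ℝ} {X₀ X : Finset (ℤ × ℤ)}

/-- Two squares which meet have a common corner, which is their coordinatewise maximum. -/
theorem common_corner (hε : 0 < ε) {s t : ℤ × ℤ} {w : ℂ} (hs : w ∈ square ε s)
    (ht : w ∈ square ε t) : ∃ u : ℤ × ℤ,
      (s.1 ≤ u.1 ∧ u.1 ≤ s.1 + 1 ∧ s.2 ≤ u.2 ∧ u.2 ≤ s.2 + 1) ∧
      (t.1 ≤ u.1 ∧ u.1 ≤ t.1 + 1 ∧ t.2 ≤ u.2 ∧ u.2 ≤ t.2 + 1) := by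
  rw [mem_square_iff_div hε] at hs ht
  have key : ∀ (i j : ℤ) (x : ℝ), (i : ℝ) ≤ x → x ≤ j + 1 → i ≤ j + 1 := by
    intro i j x h1 h2
    exact_mod_cast h1.trans h2
  have h1 := key _ _ _ hs.1.1 ht.1.2
  have h2 := key _ _ _ ht.1.1 hs.1.2
  have h3 := key _ _ _ hs.2.1 ht.2.2
  have h4 := key _ _ _ ht.2.1 hs.2.2
  refine ⟨(max s.1 t.1, max s.2 t.2), ?_, ?_⟩ <;> dsimp only <;> omega

/-- If the preimage of `K` is connected, then a function on the lattice points of the covering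
which is constant on lifts of squares is constant. -/
theorem flat_const (h : q.IsUnramifiedOn U' U) (hε : 0 < ε)
    (hK : IsCompact K)
    (hX₀K : ∀ s, (square ε s ∩ K).Nonempty → s ∈ X₀)
    (hX₀ : ∀ s ∈ X₀, (square ε s ∩ K).Nonempty) (hX₀X : X₀ ⊆ X)
    {A : ℤ} (hA : ∀ s ∈ X, A ≤ s.1)
    (hadj : ∀ s ∈ X, s ∉ X₀ → ∀ t, Adj s t → t ∈ X)
    (hXU : ∀ s ∈ X, square ε s ⊆ U)
    (hconn : IsPreconnected (U' ∩ q.eval ⁻¹' K)) (hne : (U' ∩ q.eval ⁻¹' K).Nonempty)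
    (Φ : ℤ × ℤ → ℂ → ℚ)
    (hΦ : ∀ s ∈ X, ∀ σ, q.IsSectionOn U' (square ε s) σ → ∀ t : ℤ × ℤ,
      s.1 ≤ t.1 ∧ t.1 ≤ s.1 + 1 ∧ s.2 ≤ t.2 ∧ t.2 ≤ s.2 + 1 →
      Φ t (σ (corner ε t)) = Φ s (σ (corner ε s))) :
    ∃ c, ∀ s ∈ X, ∀ σ, q.IsSectionOn U' (square ε s) σ → Φ s (σ (corner ε s)) = c := by
  have hcs : ∀ s, corner ε s ∈ square ε s := fun s => corner_mem_square hε (by omega)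
  have hex : ∀ s y, s ∈ X → y ∈ q.fiberIn U' (corner ε s) →
      ∃ σ, q.IsSectionOn U' (square ε s) σ ∧ σ (corner ε s) = y := by
    rintro s y hs ⟨hy, hys⟩
    obtain ⟨σ, hσ, hσy⟩ := h.exists_section (convex_square s) (hXU s hs) hy
      (by rw [hys]; exact hcs s)
    exact ⟨σ, hσ, by rw [← hys, hσy]⟩
  choose! S hS hSc using hex
  obtain ⟨P, hPclosed, hmemP, hPmem⟩ : ∃ P : (ℚ → Prop) → Set ℂ, (∀ p, IsClosed (P p)) ∧
      (∀ p s, s ∈ X₀ → ∀ σ, q.IsSectionOn U' (square ε s) σ → p (Φ s (σ (corner ε s))) →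
        ∀ w ∈ square ε s ∩ K, σ w ∈ P p) ∧
      (∀ p z, z ∈ P p → ∃ s ∈ X₀, ∃ σ, q.IsSectionOn U' (square ε s) σ ∧
        p (Φ s (σ (corner ε s))) ∧ q.eval z ∈ square ε s ∧ σ (q.eval z) = z) := by
    refine ⟨fun p => ⋃ s ∈ X₀, ⋃ y ∈ {y | y ∈ q.fiberIn U' (corner ε s) ∧ p (Φ s y)},
      S s y '' (square ε s ∩ K), ?_, ?_, ?_⟩
    · intro p
      refine X₀.finite_toSet.isClosed_biUnion fun s hs => ?_
      refine ((h.finite_fiberIn (corner ε s)).subset fun y hy => hy.1).isClosed_biUnion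
        fun y hy => ?_
      exact (((isCompact_square s).inter hK).image_of_continuousOn
        ((hS s y (hX₀X hs) hy.1).1.mono inter_subset_left)).isClosed
    · intro p s hs σ hσ hp w hw
      have hy : σ (corner ε s) ∈ q.fiberIn U' (corner ε s) := hσ.2 _ (hcs s)
      refine mem_biUnion hs (mem_biUnion (x := σ (corner ε s)) ⟨hy, hp⟩ ⟨w, hw, ?_⟩)
      exact h.section_eqOn (convex_square s).isPreconnected (hS s _ (hX₀X hs) hy) hσ (hcs s)
        (hSc s _ (hX₀X hs) hy) hw.1
    · intro p z hz
      simp only [mem_iUnion] at hz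
      obtain ⟨s, hs, y, ⟨hy, hp⟩, w, hw, rfl⟩ := hz
      have h1 := hS s y (hX₀X hs) hy
      refine ⟨s, hs, S s y, h1, ?_, ?_, ?_⟩
      · rwa [hSc s y (hX₀X hs) hy]
      · rw [(h1.2 w hw.1).2]; exact hw.1
      · rw [(h1.2 w hw.1).2]
  have hthrough : ∀ z ∈ U' ∩ q.eval ⁻¹' K, ∃ s ∈ X₀, ∃ σ, q.IsSectionOn U' (square ε s) σ ∧
      q.eval z ∈ square ε s ∩ K ∧ σ (q.eval z) = z := by
    rintro z ⟨hz, hzK⟩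
    have h1 := mem_floorSquare hε (q.eval z)
    have h2 := hX₀K _ ⟨_, h1, hzK⟩
    obtain ⟨σ, hσ, hσz⟩ := h.exists_section (convex_square _) (hXU _ (hX₀X h2)) hz h1
    exact ⟨_, h2, σ, hσ, ⟨h1, hzK⟩, hσz⟩
  obtain ⟨z₀, hz₀⟩ := hne
  obtain ⟨s₀, hs₀, σ₀, hσ₀, hw₀, hσz₀⟩ := hthrough z₀ hz₀
  set c := Φ s₀ (σ₀ (corner ε s₀)) with hc
  have hcore : ∀ s ∈ X₀, ∀ σ, q.IsSectionOn U' (square ε s) σ → Φ s (σ (corner ε s)) = c := by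
    intro s hs σ hσ
    by_contra hne
    obtain ⟨w, hw⟩ := hX₀ s hs
    obtain ⟨z, -, hz1, hz2⟩ := isPreconnected_closed_iff.1 hconn (P (· = c)) (P (· ≠ c))
      (hPclosed _) (hPclosed _) (by
        intro z hz
        obtain ⟨t, ht, τ, hτ, hzt, hτz⟩ := hthrough z hz
        by_cases hcase : Φ t (τ (corner ε t)) = c
        · left; rw [← hτz]; exact hmemP (· = c) t ht τ hτ hcase _ hzt
        · right; rw [← hτz]; exact hmemP (· ≠ c) t ht τ hτ hcase _ hzt)
      ⟨z₀, hz₀, by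
        have := hmemP (· = c) s₀ hs₀ σ₀ hσ₀ rfl _ hw₀
        rwa [hσz₀] at this⟩
      ⟨σ w, ⟨(hσ.2 w hw.1).1, by
        show q.eval (σ w) ∈ K
        rw [(hσ.2 w hw.1).2]; exact hw.2⟩,
        hmemP (· ≠ c) s hs σ hσ hne w hw⟩
    obtain ⟨s, hs, σ, hσ, hσc, hσs, hσz⟩ := hPmem _ _ hz1
    obtain ⟨t, ht, τ, hτ, hτc, hτt, hτz⟩ := hPmem _ _ hz2
    obtain ⟨u, hus, hut⟩ := common_corner hε hσs hτt
    have heq := h.section_eqOn ((convex_square s).inter (convex_square t)).isPreconnected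
      (hσ.mono inter_subset_left) (hτ.mono inter_subset_right) ⟨hσs, hτt⟩
      (hσz.trans hτz.symm)
      (x := corner ε u) ⟨corner_mem_square hε hus, corner_mem_square hε hut⟩
    apply hτc
    rw [← hΦ t (hX₀X ht) τ hτ u hut, ← heq, hΦ s (hX₀X hs) σ hσ u hus]
    exact hσc
  refine ⟨c, induction_left hA hadj hcore ?_⟩
  intro s hs hs1 ih σ hσ
  have hcorner : s.1 ≤ (s + (1, 0)).1 ∧ (s + (1, 0)).1 ≤ s.1 + 1 ∧ s.2 ≤ (s + (1, 0)).2 ∧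
      (s + (1, 0)).2 ≤ s.2 + 1 := by simp
  obtain ⟨h1, h2⟩ := hσ.2 _ (hcs (s + (1, 0)))
  obtain ⟨τ, hτ, hτz⟩ := h.exists_section (convex_square s) (hXU s hs) h1
    (by rw [h2]; exact corner_mem_square hε hcorner)
  rw [h2] at hτz
  rw [← hτz, hΦ s hs τ hτ _ hcorner]
  exact ih τ hτ

/-- Numberings of the fibres of an unramified polynomial map. -/
theorem _root_.Polynomial.IsUnramifiedOn.exists_numbering (h : q.IsUnramifiedOn U' U) {D : ℕ}
    (hpos : 0 < D) (hD : ∀ w ∈ U, (q.fiberIn U' w).ncard = D) :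
    ∃ dec : ℂ → Fin D → ℂ, ∃ enc : ℂ → ℂ → Fin D, ∀ w ∈ U,
      (∀ k, dec w k ∈ q.fiberIn U' w ∧ enc w (dec w k) = k) ∧
      ∀ z ∈ q.fiberIn U' w, dec w (enc w z) = z := by
  have hex : ∀ w, ∃ (d : Fin D → ℂ) (e : ℂ → Fin D), w ∈ U →
      (∀ k, d k ∈ q.fiberIn U' w ∧ e (d k) = k) ∧ ∀ z ∈ q.fiberIn U' w, d (e z) = z := by
    classical
    intro w
    by_cases hw : w ∈ U
    · have : Finite (q.fiberIn U' w) := h.finite_fiberIn w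
      have e : q.fiberIn U' w ≃ Fin D := Finite.equivFinOfCardEq (hD w hw)
      refine ⟨fun k => e.symm k, fun z => if hz : z ∈ q.fiberIn U' w then e ⟨z, hz⟩ else ⟨0, hpos⟩,
        fun _ => ⟨fun k => ⟨(e.symm k).2, by simp⟩, fun z hz => by simp [hz]⟩⟩
    · exact ⟨fun _ => 0, fun _ => ⟨0, hpos⟩, fun hw' => absurd hw' hw⟩
  choose dec enc hde using hex
  exact ⟨dec, enc, hde⟩

/-- An unramified polynomial map onto a component of a sublevel set, for which the preimage of
some nonempty compact set is connected, has degree at most one. -/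
theorem ncard_fiberIn_le_one {p : ℂ[X]} {R : ℝ} {x : ℂ}
    (h : q.IsUnramifiedOn U' (connectedComponentIn {z | ‖p.eval z‖ < R} x))
    (hK : IsCompact K) (hKU : K ⊆ connectedComponentIn {z | ‖p.eval z‖ < R} x)
    (hconn : IsPreconnected (U' ∩ q.eval ⁻¹' K)) (hne : (U' ∩ q.eval ⁻¹' K).Nonempty) {w : ℂ}
    (hw : w ∈ connectedComponentIn {z | ‖p.eval z‖ < R} x) :
    (q.fiberIn U' w).ncard ≤ 1 := by
  obtain ⟨ε, hε, X₀, hX₀K, hX₀⟩ := exists_core hK h.isOpen_target hKU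
  obtain ⟨A, B, X, hX₀X, hbox, hfill, hadj⟩ := exists_filling X₀
  have hX₀ne : X₀.Nonempty := by
    obtain ⟨z, hz, hzK⟩ := hne
    exact ⟨_, hX₀K _ ⟨_, mem_floorSquare hε _, hzK⟩⟩
  have hXU := square_subset_of_mem_filling hε (fun s hs => (hbox s hs).1) hadj p
    (fun s hs => (hX₀ s hs).2) hX₀ne
  have hUp : IsPreconnected (connectedComponentIn {z | ‖p.eval z‖ < R} x) :=
    isPreconnected_connectedComponentIn
  generalize connectedComponentIn {z | ‖p.eval z‖ < R} x = U at *
  rcases Nat.eq_zero_or_pos (q.fiberIn U' w).ncard with hD0 | hpos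
  · omega
  have hD : ∀ v ∈ U, (q.fiberIn U' v).ncard = (q.fiberIn U' w).ncard := fun v hv =>
    h.ncard_fiberIn_eq hUp hv hw
  generalize (q.fiberIn U' w).ncard = D at *
  obtain ⟨dec, enc, hde⟩ := h.exists_numbering hpos hD
  obtain ⟨T, hT⟩ := h.exists_transport
  have hcs : ∀ s, corner ε s ∈ square ε s := fun s => corner_mem_square hε (by omega)
  let τ : ℤ × ℤ → ℤ × ℤ → Fin D → Fin D := fun u v k =>
    enc (corner ε v) (T (corner ε u) (corner ε v) (dec (corner ε u) k))
  have hτ : ∀ s ∈ X, ∀ σ, q.IsSectionOn U' (square ε s) σ → ∀ u v : ℤ × ℤ,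
      corner ε u ∈ square ε s → corner ε v ∈ square ε s →
      τ u v (enc (corner ε u) (σ (corner ε u))) = enc (corner ε v) (σ (corner ε v)) := by
    intro s hs σ hσ u v hu hv
    have h1 := (hde _ (hXU s hs hu)).2 _ (hσ.2 _ hu)
    simp only [τ]
    rw [h1, hT _ (convex_square s) (hXU s hs) σ hσ _ hu _ hv]
  have hsec : ∀ s ∈ X, ∀ u : ℤ × ℤ, corner ε u ∈ square ε s → ∀ k : Fin D,
      ∃ σ, q.IsSectionOn U' (square ε s) σ ∧ enc (corner ε u) (σ (corner ε u)) = k := by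
    intro s hs u hu k
    obtain ⟨⟨h1, h2⟩, h3⟩ := (hde _ (hXU s hs hu)).1 k
    obtain ⟨σ, hσ, hσy⟩ := h.exists_section (convex_square s) (hXU s hs) h1 (by rwa [h2])
    rw [h2] at hσy
    exact ⟨σ, hσ, by rw [hσy, h3]⟩
  have hc0 : ∀ s, corner ε (s + (1, 0)) ∈ square ε s := fun s =>
    corner_mem_square hε (by simp)
  have hc1 : ∀ s, corner ε (s + (0, 1)) ∈ square ε s := fun s =>
    corner_mem_square hε (by simp)
  have hc2 : ∀ s, corner ε (s + (1, 0) + (0, 1)) ∈ square ε s := fun s =>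
    corner_mem_square hε (by simp)
  refine rank_le_one_of_flat_const (hX₀ne.mono hX₀X) hbox hfill
    (fun v => LinearMap.funLeft ℚ ℚ (τ (v + (1, 0)) v))
    (fun v => LinearMap.funLeft ℚ ℚ (τ (v + (0, 1)) v)) ?_ ?_
  · intro s hs φ
    ext k
    obtain ⟨σ, hσ, rfl⟩ := hsec s hs _ (hc2 s) k
    simp only [LinearMap.funLeft_apply]
    have hcomm : s + (0, 1) + (1, 0) = s + (1, 0) + (0, 1) := add_right_comm _ _ _
    rw [hcomm, hτ s hs σ hσ _ _ (hc2 s) (hc0 s), hτ s hs σ hσ _ _ (hc0 s) (hcs s),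
      hτ s hs σ hσ _ _ (hc2 s) (hc1 s), hτ s hs σ hσ _ _ (hc1 s) (hcs s)]
  · intro φ hφh hφv
    have hh : ∀ s ∈ X, ∀ σ, q.IsSectionOn U' (square ε s) σ → ∀ u ∈ hEdges X,
        corner ε u ∈ square ε s → corner ε (u + (1, 0)) ∈ square ε s →
        φ (u + (1, 0)) (enc (corner ε (u + (1, 0))) (σ (corner ε (u + (1, 0))))) =
        φ u (enc (corner ε u) (σ (corner ε u))) := by
      intro s hs σ hσ u hu h1 h2
      rw [hφh u hu, LinearMap.funLeft_apply, hτ s hs σ hσ _ _ h2 h1]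
    have hv : ∀ s ∈ X, ∀ σ, q.IsSectionOn U' (square ε s) σ → ∀ u ∈ vEdges X,
        corner ε u ∈ square ε s → corner ε (u + (0, 1)) ∈ square ε s →
        φ (u + (0, 1)) (enc (corner ε (u + (0, 1))) (σ (corner ε (u + (0, 1))))) =
        φ u (enc (corner ε u) (σ (corner ε u))) := by
      intro s hs σ hσ u hu h1 h2
      rw [hφv u hu, LinearMap.funLeft_apply, hτ s hs σ hσ _ _ h2 h1]
    have hΦ : ∀ s ∈ X, ∀ σ, q.IsSectionOn U' (square ε s) σ → ∀ t : ℤ × ℤ,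
        s.1 ≤ t.1 ∧ t.1 ≤ s.1 + 1 ∧ s.2 ≤ t.2 ∧ t.2 ≤ s.2 + 1 →
        φ t (enc (corner ε t) (σ (corner ε t))) = φ s (enc (corner ε s) (σ (corner ε s))) := by
      intro s hs σ hσ t ht
      have ht' : t = s ∨ t = s + (1, 0) ∨ t = s + (0, 1) ∨ t = s + (1, 0) + (0, 1) := by
        simp only [Prod.ext_iff, Prod.fst_add, Prod.snd_add]
        omega
      have e1 := hh s hs σ hσ s (mem_hEdges.2 (Or.inl hs)) (hcs s) (hc0 s)
      have e2 := hv s hs σ hσ s (mem_vEdges.2 (Or.inl hs)) (hcs s) (hc1 s)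
      have e3 := hv s hs σ hσ (s + (1, 0)) (mem_vEdges.2 (Or.inr (by simpa using hs)))
        (hc0 s) (hc2 s)
      rcases ht' with rfl | rfl | rfl | rfl
      · rfl
      · exact e1
      · exact e2
      · exact e3.trans e1
    obtain ⟨c, hc⟩ := flat_const h hε hK hX₀K (fun s hs => (hX₀ s hs).1) hX₀X
      (fun s hs => (hbox s hs).1) hadj hXU hconn hne
      (fun v z => φ v (enc (corner ε v) z)) hΦ
    refine ⟨c, fun v hv k => ?_⟩
    obtain ⟨s, hs, hsv⟩ : ∃ s ∈ X, s.1 ≤ v.1 ∧ v.1 ≤ s.1 + 1 ∧ s.2 ≤ v.2 ∧ v.2 ≤ s.2 + 1 := by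
      rw [mem_vertices, mem_hEdges, mem_hEdges] at hv
      rcases hv with (hv | hv) | (hv | hv)
      all_goals exact ⟨_, hv, by simp⟩
    obtain ⟨σ, hσ, rfl⟩ := hsec s hs v (corner_mem_square hε hsv) k
    exact (hΦ s hs σ hσ v hsv).trans (hc s hs σ hσ)

end SquareComplex

/-! ### Contraction of relatively compact holomorphic self-maps -/

section Contraction

variable {U V K : Set ℂ} {h : ℂ → ℂ}

/-- The iterates of a holomorphic self-map of a bounded open set with relatively compact image
have exponentially decaying derivatives. -/
theorem exists_norm_deriv_iterate_le (hU : IsOpen U) (hb : Bornology.IsBounded U)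
    (hd : DifferentiableOn ℂ h U) (hV : MapsTo h U V) (hVc : IsCompact (closure V))
    (hVU : closure V ⊆ U) :
    ∃ M δ : ℝ, 0 < δ ∧ ∀ (k : ℕ) (r : ℝ), 0 < r → ∀ x, Metric.closedBall x r ⊆ U →
      DifferentiableAt ℂ h^[k] x ∧ ‖deriv h^[k] x‖ * (1 + δ) ^ k ≤ M / r := by
  obtain ⟨η, hη, hηU⟩ := hVc.exists_cthickening_subset_open hU hVU
  obtain ⟨M, hM0, hM⟩ := hb.exists_pos_norm_le
  have hhU : MapsTo h U U := fun z hz => hVU (subset_closure (hV hz))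
  have hδ : 0 < η / (2 * M) := by positivity
  refine ⟨M, η / (2 * M), hδ, ?_⟩
  set δ := η / (2 * M) with hδe
  have hψ : ∀ x ∈ U, MapsTo (fun z => h z + δ * (h z - h x)) U U := by
    intro x hx z hz
    apply hηU
    refine Metric.mem_cthickening_of_dist_le _ (h z) η _ (subset_closure (hV hz)) ?_
    rw [dist_eq_norm, add_sub_cancel_left, norm_mul, Complex.norm_real, Real.norm_eq_abs,
      abs_of_pos hδ]
    have h1 : ‖h z - h x‖ ≤ 2 * M := by
      have := norm_sub_le (h z) (h x)
      linarith [hM _ (hhU hz), hM _ (hhU hx)]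
    calc δ * ‖h z - h x‖ ≤ δ * (2 * M) := by gcongr
      _ = η := by rw [hδe]; field_simp
  have key : ∀ (k : ℕ), ∀ x ∈ U, DifferentiableAt ℂ h^[k] x ∧ h^[k] x ∈ U ∧
      ∃ Ψ : ℂ → ℂ, DifferentiableOn ℂ Ψ U ∧ MapsTo Ψ U U ∧ Ψ x = h^[k] x ∧
        HasDerivAt Ψ ((1 + δ) ^ k * deriv h^[k] x) x := by
    intro k
    induction k with
    | zero =>
      intro x hx
      exact ⟨differentiableAt_id, hx, id, differentiableOn_id, mapsTo_id _, rfl, by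
        simpa using hasDerivAt_id x⟩
    | succ k ih =>
      intro x hx
      obtain ⟨h1, h2, Ψ, h3, h4, h5, h6⟩ := ih x hx
      have hdx := (hd.differentiableAt (hU.mem_nhds h2)).hasDerivAt
      have hcomp : HasDerivAt h^[k + 1] (deriv h (h^[k] x) * deriv h^[k] x) x := by
        rw [Function.iterate_succ']
        exact hdx.comp x h1.hasDerivAt
      refine ⟨hcomp.differentiableAt, ?_, (fun z => h z + δ * (h z - h (h^[k] x))) ∘ Ψ, ?_,
        (hψ _ h2).comp h4, ?_, ?_⟩
      · rw [Function.iterate_succ_apply']; exact hhU h2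
      · refine DifferentiableOn.comp (t := U) ?_ h3 h4
        exact hd.add ((hd.sub_const _).const_mul _)
      · rw [Function.comp_apply, h5, Function.iterate_succ_apply']; simp
      · have h7 : HasDerivAt (fun z => h z + δ * (h z - h (h^[k] x)))
            (deriv h (h^[k] x) + δ * deriv h (h^[k] x)) (Ψ x) := by
          rw [h5]
          exact hdx.add ((hdx.sub_const _).const_mul _)
        rw [hcomp.deriv]
        refine (h7.comp x h6).congr_deriv ?_
        ring
  intro k r hr x hx
  have hxU : x ∈ U := hx (Metric.mem_closedBall_self hr.le)
  obtain ⟨h1, -, Ψ, h3, h4, -, h6⟩ := key k x hxU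
  refine ⟨h1, ?_⟩
  have h7 := Complex.norm_deriv_le_of_forall_mem_sphere_norm_le (f := Ψ) (c := x) (C := M) hr
    (h3.diffContOnCl_ball hx) (fun z hz => hM _ (h4 (hx (Metric.sphere_subset_closedBall hz))))
  rw [h6.deriv, norm_mul, norm_pow] at h7
  have h8 : ‖(1 + δ : ℂ)‖ = 1 + δ := by
    rw [← Complex.ofReal_one, ← Complex.ofReal_add, Complex.norm_real, Real.norm_eq_abs,
      abs_of_pos (by linarith)]
  rw [h8] at h7
  linarith

/-- A compact set which is mapped onto itself by a local contraction is finite. -/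
theorem finite_of_locally_contracting {H : ℂ → ℂ} {r : ℝ} (hr : 0 < r) (hK : IsCompact K)
    (hHK : H '' K = K)
    (hH : ∀ x ∈ K, ∀ y ∈ K, dist x y < r → dist (H x) (H y) ≤ 1 / 2 * dist x y) :
    K.Finite := by
  classical
  by_contra hinf
  have hmaps : MapsTo H K K := mapsTo_iff_image_subset.2 hHK.subset
  have hsurj : SurjOn H K K := hHK.superset
  have hiter : ∀ (j : ℕ), ∀ x ∈ K, ∀ y ∈ K, dist x y < r →
      dist (H^[j] x) (H^[j] y) ≤ (1 / 2) ^ j * dist x y := by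
    intro j
    induction j with
    | zero => intro x _ y _ _; simp
    | succ j ih =>
      intro x hx y hy hxy
      have h1 := hH x hx y hy hxy
      have h2 := ih _ (hmaps hx) _ (hmaps hy) (by linarith [dist_nonneg (x := x) (y := y)])
      rw [Function.iterate_succ_apply, Function.iterate_succ_apply]
      calc _ ≤ _ := h2
        _ ≤ (1 / 2) ^ j * (1 / 2 * dist x y) := by gcongr
        _ = _ := by ring
  obtain ⟨t, -, htf, hcov⟩ := hK.finite_cover_balls (half_pos hr)
  obtain ⟨F, hFK, hF⟩ := Set.Infinite.exists_subset_card_eq hinf (htf.toFinset.card + 1)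
  have hev : ∀ᶠ j : ℕ in atTop, ∀ p ∈ F ×ˢ F, p.1 ≠ p.2 →
      (1 / 2 : ℝ) ^ j * r < dist p.1 p.2 := by
    rw [Filter.eventually_all_finset]
    intro p _
    by_cases hp : p.1 = p.2
    · simp [hp]
    · have h1 : Tendsto (fun j : ℕ => (1 / 2 : ℝ) ^ j * r) atTop (𝓝 (0 * r)) :=
        (tendsto_pow_atTop_nhds_zero_of_lt_one (by norm_num) (by norm_num)).mul_const r
      rw [zero_mul] at h1
      filter_upwards [h1.eventually_lt_const (dist_pos.2 hp)] with j hj _ using hj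
  obtain ⟨j, hj⟩ := hev.exists
  have hpre : ∀ y, y ∈ F → ∃ c y', c ∈ t ∧ y' ∈ K ∧ dist y' c < r / 2 ∧ H^[j] y' = y := by
    intro y hy
    obtain ⟨y', hy', rfl⟩ := hsurj.iterate j (hFK hy)
    obtain ⟨c, hc, hcy⟩ := mem_iUnion₂.1 (hcov hy')
    exact ⟨c, y', hc, hy', hcy, rfl⟩
  choose! c y' hc hy' hcy hHy using hpre
  obtain ⟨a, ha, b, hb, hab, hcab⟩ := Finset.exists_ne_map_eq_of_card_lt_of_maps_to
    (s := F) (t := htf.toFinset) (by omega) (f := c) (fun y hy => by simpa using hc y hy)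
  have h1 := hj (a, b) (Finset.mem_product.2 ⟨ha, hb⟩) hab
  have h2 : dist (y' a) (y' b) < r := by
    have := dist_triangle_right (y' a) (y' b) (c a)
    have h3 := hcy a ha
    have h4 := hcy b hb
    rw [← hcab] at h4
    linarith
  have h3 := hiter j _ (hy' a ha) _ (hy' b hb) h2
  rw [hHy a ha, hHy b hb] at h3
  have h4 : (1 / 2 : ℝ) ^ j * dist (y' a) (y' b) ≤ (1 / 2) ^ j * r := by gcongr
  simp only at h1
  linarith

/-- A compact set which is mapped onto itself by a holomorphic self-map of a bounded open set with
relatively compact image is finite. -/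
theorem finite_of_image_eq (hU : IsOpen U) (hb : Bornology.IsBounded U)
    (hd : DifferentiableOn ℂ h U) (hV : MapsTo h U V) (hVc : IsCompact (closure V))
    (hVU : closure V ⊆ U) (hK : IsCompact K) (hKU : K ⊆ U) (hhK : h '' K = K) : K.Finite := by
  obtain ⟨M, δ, hδ, hbound⟩ := exists_norm_deriv_iterate_le hU hb hd hV hVc hVU
  obtain ⟨r, hr, hrU⟩ := hK.exists_cthickening_subset_open hU hKU
  have hr2 : 0 < r / 2 := by positivity
  obtain ⟨k, hk⟩ := pow_unbounded_of_one_lt (2 * (M / (r / 2))) (show 1 < 1 + δ by linarith)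
  have hball : ∀ x ∈ K, ∀ z ∈ Metric.ball x (r / 2), Metric.closedBall z (r / 2) ⊆ U := by
    intro x hx z hz w hw
    refine hrU (Metric.mem_cthickening_of_dist_le w x r K hx ?_)
    have := dist_triangle w z x
    rw [Metric.mem_ball] at hz
    rw [Metric.mem_closedBall] at hw
    linarith
  refine finite_of_locally_contracting (H := h^[k]) hr2 hK ?_ ?_
  · exact (congrFun Set.image_iterate_eq K).trans (Function.iterate_fixed hhK k)
  · intro x hx y hy hxy
    rw [dist_eq_norm, dist_eq_norm]
    refine (convex_ball x (r / 2)).norm_image_sub_le_of_norm_deriv_le (f := h^[k]) (𝕜 := ℂ)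
      (fun z hz => (hbound k _ hr2 z (hball x hx z hz)).1) ?_ ?_ ?_
    · intro z hz
      have h1 := (hbound k _ hr2 z (hball x hx z hz)).2
      by_contra! h2
      have h3 : 1 / 2 * (1 + δ) ^ k ≤ ‖deriv h^[k] z‖ * (1 + δ) ^ k := by gcongr
      linarith
    · rwa [Metric.mem_ball, dist_comm]
    · exact Metric.mem_ball_self hr2

end Contraction

/-! ### Periodic components of the filled Julia set -/

theorem IsPreconnected.subsingleton_of_finite {s : Set ℂ} (hs : IsPreconnected s)
    (hf : s.Finite) : s.Subsingleton :=
  hf.countable.isTotallyDisconnected s Subset.rfl hs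

/-- A component of the filled Julia set which is mapped to itself by an iterate without critical
points in the component is finite. -/
theorem Polynomial.IsEscapeRadius.finite_component {f : ℂ[X]} {R : ℝ} (h : f.IsEscapeRadius R)
    (hf : f.natDegree ≠ 0) {x : ℂ} (hx : x ∈ f.filledJulia) {m : ℕ} (hm : 1 ≤ m)
    (hgx : (f.iter m).eval x ∈ connectedComponentIn f.filledJulia x)
    (hcrit : ∀ z ∈ connectedComponentIn f.filledJulia x, (f.iter m).derivative.eval z ≠ 0) :
    (connectedComponentIn f.filledJulia x).Finite := by
  have hxn : ∀ n, x ∈ f.sublevel R n := by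
    rw [h.filledJulia_eq] at hx; exact mem_iInter.1 hx
  have hKfn : ∀ n, f.filledJulia ⊆ f.sublevel R n := fun n => by
    rw [h.filledJulia_eq]; exact iInter_subset _ n
  have hgdeg : (f.iter m).natDegree ≠ 0 := by
    rw [natDegree_iter]; exact pow_ne_zero _ hf
  have hgK : (f.iter m).eval '' connectedComponentIn f.filledJulia x =
      connectedComponentIn f.filledJulia x := by
    rw [h.image_component hf hx m, ← connectedComponentIn_eq hgx]
  have hxK : x ∈ connectedComponentIn f.filledJulia x := mem_connectedComponentIn hx
  have hfin : ({z | (f.iter m).derivative.eval z = 0} ∪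
      ((f.iter m).eval ⁻¹' {x} \ connectedComponentIn f.filledJulia x)).Finite := by
    refine Set.Finite.union ?_ (((f.iter m).finite_preimage_singleton hgdeg x).subset
      sdiff_subset)
    refine finite_setOfPred_isRoot fun h0 => hcrit x hxK ?_
    rw [h0, eval_zero]
  obtain ⟨N, hN⟩ := h.exists_component_subset hx hfin.isClosed.isOpen_compl (by
    rintro z hz (h1 | h1)
    · exact hcrit z hz h1
    · exact h1.2 hz)
  have hU'V := hN (N + m) (Nat.le_add_right _ _)
  have hsubn : ∀ n, connectedComponentIn f.filledJulia x ⊆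
      connectedComponentIn (f.sublevel R n) x := fun n => connectedComponentIn_mono _ (hKfn n)
  have hUeq : connectedComponentIn (f.sublevel R N) ((f.iter m).eval x) =
      connectedComponentIn (f.sublevel R N) x := (connectedComponentIn_eq (hsubn N hgx)).symm
  have himg := h.image_component_sublevel hf hx N m
  rw [hUeq] at himg
  have hur : (f.iter m).IsUnramifiedOn (connectedComponentIn (f.sublevel R (N + m)) x)
      (connectedComponentIn (f.sublevel R N) x) :=
    { natDegree_ne := hgdeg
      isOpen_source := (f.isOpen_sublevel R _).connectedComponentIn
      isOpen_target := (f.isOpen_sublevel R _).connectedComponentIn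
      mapsTo := fun z hz => himg ▸ mem_image_of_mem _ hz
      closure_inter := by
        refine Subset.trans ?_ (closure_connectedComponentIn_inter_subset (f.sublevel R (N + m)) x)
        refine inter_subset_inter_right _ ?_
        rw [← preimage_sublevel]
        exact preimage_mono (connectedComponentIn_subset _ _)
      deriv_ne := fun z hz h0 => hU'V hz (Or.inl h0) }
  have hpre : connectedComponentIn (f.sublevel R (N + m)) x ∩
      (f.iter m).eval ⁻¹' connectedComponentIn f.filledJulia x =
      connectedComponentIn f.filledJulia x := by
    refine Subset.antisymm ?_ fun z hz => ⟨hsubn _ hz, hgK ▸ mem_image_of_mem _ hz⟩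
    rintro z ⟨hz, hzK⟩
    have hzf : z ∈ f.filledJulia :=
      (h.iter_mem_filledJulia m).1 (connectedComponentIn_subset _ _ hzK)
    obtain ⟨y, hy, hyx⟩ : x ∈ (f.iter m).eval '' connectedComponentIn f.filledJulia z := by
      rw [h.image_component hf hzf m, ← connectedComponentIn_eq hzK]
      exact hxK
    have hyU : y ∈ connectedComponentIn (f.sublevel R (N + m)) x := by
      rw [connectedComponentIn_eq hz]
      exact connectedComponentIn_mono _ (hKfn _) hy
    have hyK : y ∈ connectedComponentIn f.filledJulia x := by
      by_contra h1
      exact hU'V hyU (Or.inr ⟨hyx, h1⟩)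
    rw [connectedComponentIn_eq hyK, ← connectedComponentIn_eq hy]
    exact mem_connectedComponentIn hzf
  have hK := h.isCompact_component hx
  have hone : ∀ w ∈ connectedComponentIn (f.sublevel R N) x, ((f.iter m).fiberIn
      (connectedComponentIn (f.sublevel R (N + m)) x) w).ncard ≤ 1 := fun w hw =>
    SquareComplex.ncard_fiberIn_le_one (p := f.iter N) (R := R) (x := x) hur hK (hsubn N)
      (by rw [hpre]; exact isPreconnected_connectedComponentIn) (by rw [hpre]; exact ⟨x, hxK⟩) hw
  have hexi : ∀ w, w ∈ connectedComponentIn (f.sublevel R N) x →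
      ∃ z, z ∈ connectedComponentIn (f.sublevel R (N + m)) x ∧ (f.iter m).eval z = w := by
    intro w hw
    rw [← himg] at hw
    exact hw
  choose! k hkU hk using hexi
  have huniq : ∀ w ∈ connectedComponentIn (f.sublevel R N) x,
      ∀ z ∈ connectedComponentIn (f.sublevel R (N + m)) x, (f.iter m).eval z = w → z = k w :=
    fun w hw z hz hzw => (Set.ncard_le_one (hur.finite_fiberIn w)).1 (hone w hw) z ⟨hz, hzw⟩ _
      ⟨hkU w hw, hk w hw⟩
  have hkd : DifferentiableOn ℂ k (connectedComponentIn (f.sublevel R N) x) := by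
    intro w hw
    obtain ⟨r, hr, hball⟩ := Metric.isOpen_iff.1 hur.isOpen_target w hw
    have hmem := Metric.ball_mem_nhds w hr
    obtain ⟨σ, hσ, -⟩ := hur.exists_section (convex_ball w r) hball (hkU w hw)
      (by rw [hk w hw]; exact Metric.mem_ball_self hr)
    have hσk : EqOn σ k (Metric.ball w r) := fun v hv =>
      huniq v (hball hv) _ (hσ.2 v hv).1 (hσ.2 v hv).2
    have hcont : ContinuousAt k w :=
      (hσ.1.continuousAt hmem).congr (hσk.eventuallyEq_of_mem hmem)
    refine (HasDerivAt.of_local_left_inverse hcont ((f.iter m).hasDerivAt (k w))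
      (hur.deriv_ne _ (hkU w hw)) ?_).differentiableAt.differentiableWithinAt
    filter_upwards [hmem] with v hv using hk v (hball hv)
  have hcl : closure (connectedComponentIn (f.sublevel R (N + m)) x) ⊆
      connectedComponentIn (f.sublevel R N) x := by
    obtain ⟨l, rfl⟩ := Nat.exists_eq_add_of_le' hm
    exact (h.closure_component_subset hx (N + l)).trans
      (connectedComponentIn_mono _ (h.antitone_sublevel (Nat.le_add_right _ _)))
  have hcompact : ∀ n, IsCompact (closure (connectedComponentIn (f.sublevel R n) x)) := fun n =>
    (h.isCompact_closure_sublevel n).of_isClosed_subset isClosed_closure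
      (closure_mono (connectedComponentIn_subset _ _))
  refine finite_of_image_eq (h := k) hur.isOpen_target
    ((hcompact N).isBounded.subset subset_closure) hkd hkU (hcompact _) hcl hK (hsubn N) ?_
  refine Subset.antisymm ?_ fun z hz => ?_
  · rintro _ ⟨w, hw, rfl⟩
    rw [← hpre]
    refine ⟨hkU w (hsubn N hw), ?_⟩
    rw [mem_preimage, hk w (hsubn N hw)]
    exact hw
  · have hgz : (f.iter m).eval z ∈ connectedComponentIn f.filledJulia x :=
      hgK ▸ mem_image_of_mem _ hz
    exact ⟨_, hgz, (huniq _ (hsubn N hgz) z (hsubn _ hz) rfl).symm⟩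

/-- The derivative of an iterate does not vanish along an orbit which avoids critical points. -/
theorem Polynomial.derivative_iter_eval_ne_zero (f : ℂ[X]) (z : ℂ) (m : ℕ)
    (h : ∀ j < m, f.derivative.eval ((f.iter j).eval z) ≠ 0) :
    (f.iter m).derivative.eval z ≠ 0 := by
  induction m with
  | zero => simp [iter]
  | succ m ih =>
    have h1 : f.iter (m + 1) = f.comp (f.iter m) := Function.iterate_succ_apply' _ _ _
    rw [h1, derivative_comp, eval_mul, eval_comp]
    exact mul_ne_zero (ih fun j hj => h j (by omega)) (h m (by omega))

/-- For a polynomial of degree `≥ 2` with disconnected Julia set: a connected component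
`K` of the filled-in Julia set whose forward orbit is eventually periodic, with no
critical point in the periodic cycle, is a single point. -/
theorem periodic_component_without_critical_point_is_point
    (f : Polynomial ℂ) (d : ℕ) (hd : 2 ≤ d) (hdeg : f.natDegree = d)
    (Kf : Set ℂ)
    (hKf : Kf = {z : ℂ | Bornology.IsBounded
      (Set.range fun n : ℕ => (fun w : ℂ => f.eval w)^[n] z)})
    (Jf : Set ℂ) (hJf : Jf = frontier Kf)
    (hdis : ¬ IsConnected Jf)
    (K : Set ℂ) (hKcomp : ∃ x ∈ Kf, K = connectedComponentIn Kf x)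
    (n m : ℕ) (hm : 1 ≤ m)
    (hper : (fun w : ℂ => f.eval w)^[n + m] '' K = (fun w : ℂ => f.eval w)^[n] '' K)
    (hnocrit : ¬ ∃ j < m, ∃ c : ℂ, f.derivative.eval c = 0 ∧
      c ∈ (fun w : ℂ => f.eval w)^[n + j] '' K) :
    ∃ z : ℂ, K = {z} := by
  obtain ⟨x, hx, rfl⟩ := hKcomp
  change Kf = f.filledJulia at hKf
  subst hKf
  have hf : f.natDegree ≠ 0 := by omega
  obtain ⟨R, hR⟩ : ∃ R, f.IsEscapeRadius R := f.exists_escape_radius_s3 (by omega)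
  simp only [← eval_iter] at hper hnocrit
  have hxK : x ∈ connectedComponentIn f.filledJulia x := mem_connectedComponentIn hx
  have hn := hR.image_component hf hx n
  have hfin : (connectedComponentIn f.filledJulia ((f.iter n).eval x)).Finite := by
    refine hR.finite_component hf ((hR.iter_mem_filledJulia n).2 hx) hm ?_ ?_
    · rw [← hn, ← hper, ← eval_iter_add, add_comm m n]
      exact mem_image_of_mem _ hxK
    · intro z hz
      rw [← hn] at hz
      obtain ⟨y, hy, rfl⟩ := hz
      refine f.derivative_iter_eval_ne_zero _ m fun j hj h0 => hnocrit ⟨j, hj, _, h0, y, hy, ?_⟩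
      rw [← eval_iter_add, add_comm]
  have hsub := isPreconnected_connectedComponentIn.subsingleton_of_finite hfin
  have hndeg : (f.iter n).natDegree ≠ 0 := by
    rw [natDegree_iter]; exact pow_ne_zero _ hf
  have hKfin : (connectedComponentIn f.filledJulia x).Finite := by
    refine ((f.iter n).finite_preimage_singleton hndeg ((f.iter n).eval x)).subset fun z hz => ?_
    exact hsub (hn ▸ mem_image_of_mem _ hz) (hn ▸ mem_image_of_mem _ hxK)
  exact ⟨x, (isPreconnected_connectedComponentIn.subsingleton_of_finite hKfin).eq_singleton_of_mem
    hxK⟩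
end

section
/- Let f be a complex polynomial of degree d ≥ 2. The Julia set J_f is connected if and only if every critical point of f belongs to the filled-in Julia set K_f, i.e. every zero of f′ has bounded forward orbit under f. -/
open Polynomial Topology Filter Set unitInterval

namespace PolynomialDynamics

/-! ### Topological preliminaries -/

theorem disjoint_frontier_connectedComponentIn {E : Set ℂ} (hE : IsOpen E) (z : ℂ) :
    Disjoint (frontier (connectedComponentIn E z)) E := by
  rw [Set.disjoint_left]
  intro x hx hxE
  have hxo : IsOpen (connectedComponentIn E x) := hE.connectedComponentIn
  obtain ⟨y, hyx, hyz⟩ := mem_closure_iff.1 (frontier_subset_closure hx) _ hxo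
    (mem_connectedComponentIn hxE)
  have h : connectedComponentIn E x = connectedComponentIn E z :=
    (connectedComponentIn_eq hyx).trans (connectedComponentIn_eq hyz).symm
  have hmem : x ∈ connectedComponentIn E z := h ▸ mem_connectedComponentIn hxE
  rw [(hE.connectedComponentIn).frontier_eq] at hx
  exact hx.2 hmem

theorem isPreconnected_iInter_of_antitone {X : Type*} [TopologicalSpace X] [T2Space X]
    {V : ℕ → Set X} (hV : Antitone V) (hc : ∀ n, IsCompact (V n))
    (hp : ∀ n, IsPreconnected (V n)) : IsPreconnected (⋂ n, V n) := by
  have hcl : IsClosed (⋂ n, V n) := isClosed_iInter fun n => (hc n).isClosed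
  have hco : IsCompact (⋂ n, V n) := (hc 0).of_isClosed_subset hcl (iInter_subset _ 0)
  rw [isPreconnected_iff_subset_of_disjoint_closed]
  intro u v hu hv huv hd
  obtain ⟨U, U', hU, hU', huU, hvU', hUU'⟩ := SeparatedNhds.of_isCompact_isCompact
    (hco.inter_right hu) (hco.inter_right hv) (by
      rw [Set.disjoint_left]
      rintro x ⟨hx, hxu⟩ ⟨-, hxv⟩
      exact (hd ▸ (⟨hx, hxu, hxv⟩ : x ∈ (⋂ n, V n) ∩ (u ∩ v)) : x ∈ (∅ : Set X)))
  obtain ⟨n, hn⟩ := exists_subset_nhds_of_isCompact' (V := V) (U := U ∪ U')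
    hV.directed_ge hc (fun n => (hc n).isClosed) (by
      intro x hx
      refine (hU.union hU').mem_nhds ?_
      rcases huv hx with h | h
      · exact .inl (huU ⟨hx, h⟩)
      · exact .inr (hvU' ⟨hx, h⟩))
  have hdj : V n ∩ (U ∩ U') = ∅ := by
    rw [hUU'.inter_eq, inter_empty]
  rcases isPreconnected_iff_subset_of_disjoint.1 (hp n) U U' hU hU' hn hdj with h | h
  · left
    intro x hx
    rcases huv hx with h' | h'
    · exact h'
    · exact (Set.disjoint_left.1 hUU' (h (mem_iInter.1 hx n)) (hvU' ⟨hx, h'⟩)).elim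
  · right
    intro x hx
    rcases huv hx with h' | h'
    · exact (Set.disjoint_left.1 hUU' (huU ⟨hx, h'⟩) (h (mem_iInter.1 hx n))).elim
    · exact h'

theorem isPreconnected_lt_norm_pow {N : ℕ} (hN : N ≠ 0) {r : ℝ} (hr : 0 < r) :
    IsPreconnected {w : ℂ | r < ‖w ^ N‖} := by
  have hN' : (0 : ℝ) < N := by positivity
  have h : {w : ℂ | r < ‖w ^ N‖} = Complex.exp '' {u : ℂ | Real.log r / N < u.re} := by
    have key : ∀ u : ℂ, r < ‖Complex.exp u ^ N‖ ↔ Real.log r / N < u.re := by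
      intro u
      rw [← Complex.exp_nat_mul, Complex.norm_exp, ← Real.log_lt_iff_lt_exp hr, div_lt_iff₀ hN']
      simp [mul_comm]
    ext w
    constructor
    · intro hw
      have hw0 : w ≠ 0 := by
        rintro rfl
        simp only [mem_ofPred_eq, zero_pow hN, norm_zero] at hw
        exact absurd hw hr.not_gt
      refine ⟨Complex.log w, (key _).1 ?_, Complex.exp_log hw0⟩
      rwa [Complex.exp_log hw0]
    · rintro ⟨u, hu, rfl⟩
      exact (key u).2 hu
  rw [h]
  exact (convex_halfSpace_re_gt _).isPreconnected.image _ Complex.continuous_exp.continuousOn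

/-! ### Polynomial maps -/

theorem not_eventually_eval_eq {P : ℂ[X]} (hP : P.natDegree ≠ 0) (z : ℂ) :
    ¬ ∀ᶠ x in 𝓝 z, P.eval x = P.eval z := by
  intro h
  have hinf : {x | P.eval x = (C (P.eval z)).eval x}.Infinite := by
    refine infinite_of_mem_nhds z ?_
    filter_upwards [h] with x hx
    rw [eval_C, hx]
  apply hP
  rw [Polynomial.eq_of_infinite_eval_eq _ _ hinf, natDegree_C]

theorem isOpenMap_eval {P : ℂ[X]} (hP : P.natDegree ≠ 0) : IsOpenMap fun z => P.eval z := by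
  refine IsOpenMap.of_nhds_le fun z => ?_
  have hd : Differentiable ℂ fun z => P.eval z := P.differentiable
  exact (hd.analyticAt z).eventually_constant_or_nhds_le_map_nhds.resolve_left
    (not_eventually_eval_eq hP z)

theorem exists_two_mul_norm_le_norm_eval {f : ℂ[X]} (hf : 2 ≤ f.natDegree) :
    ∃ R : ℝ, 0 < R ∧ ∀ z : ℂ, R ≤ ‖z‖ → 2 * ‖z‖ ≤ ‖f.eval z‖ := by
  have hq : 0 < f.divX.degree := by
    rw [← natDegree_pos_iff_degree_pos, natDegree_divX_eq_natDegree_tsub_one]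
    omega
  have ht := f.divX.tendsto_norm_atTop hq (tendsto_norm_cocompact_atTop (E := ℂ))
  have h3 := ht.eventually_ge_atTop 3
  rw [← Metric.cobounded_eq_cocompact, ← comap_norm_atTop, eventually_comap] at h3
  obtain ⟨R, hR⟩ := eventually_atTop.1 h3
  refine ⟨max (max R ‖f.coeff 0‖) 1, by positivity, fun z hz => ?_⟩
  have h1 : R ≤ ‖z‖ := le_trans (le_trans (le_max_left _ _) (le_max_left _ _)) hz
  have h2 : ‖f.coeff 0‖ ≤ ‖z‖ := le_trans (le_trans (le_max_right _ _) (le_max_left _ _)) hz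
  have h := hR _ h1 z rfl
  have he : f.eval z = f.divX.eval z * z + f.coeff 0 := by
    conv_lhs => rw [← f.divX_mul_X_add]
    simp
  rw [he]
  have := norm_sub_le_norm_add (f.divX.eval z * z) (f.coeff 0)
  rw [norm_mul] at this
  nlinarith [norm_nonneg z]

/-- The radial homotopy of `ℂ` retracting the plane onto the closed ball of radius `R`. -/
noncomputable def radialRetract (R : ℝ) (t : ℝ) (z : ℂ) : ℂ :=
  (((1 - t) + t * (R / max R ‖z‖) : ℝ) : ℂ) * z

theorem continuous_radialRetract {R : ℝ} (hR : 0 < R) :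
    Continuous fun p : ℝ × ℂ => radialRetract R p.1 p.2 := by
  unfold radialRetract
  have h : ∀ p : ℝ × ℂ, max R ‖p.2‖ ≠ 0 := fun p => (lt_max_of_lt_left hR).ne'
  fun_prop (disch := exact h _)

theorem radialRetract_zero (R : ℝ) (z : ℂ) : radialRetract R 0 z = z := by
  simp [radialRetract]

theorem radialRetract_of_norm_le {R : ℝ} (hR : 0 < R) (t : ℝ) {z : ℂ} (hz : ‖z‖ ≤ R) :
    radialRetract R t z = z := by
  simp [radialRetract, max_eq_left hz, hR.ne']

theorem norm_radialRetract {R : ℝ} {t : ℝ} (ht : t ∈ I) {z : ℂ} (hR : 0 < R) (hz : R ≤ ‖z‖) :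
    ‖radialRetract R t z‖ = (1 - t) * ‖z‖ + t * R := by
  have hz0 : 0 < ‖z‖ := hR.trans_le hz
  have h : 0 ≤ (1 - t) + t * (R / ‖z‖) :=
    add_nonneg (sub_nonneg.2 ht.2) (mul_nonneg ht.1 (by positivity))
  rw [radialRetract, norm_mul, max_eq_right hz, Complex.norm_real, Real.norm_of_nonneg h]
  field_simp

theorem norm_radialRetract_le {R : ℝ} (hR : 0 < R) {t : ℝ} (ht : t ∈ I) (z : ℂ) :
    ‖radialRetract R t z‖ ≤ ‖z‖ := by
  rcases le_total ‖z‖ R with h | h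
  · rw [radialRetract_of_norm_le hR t h]
  · rw [norm_radialRetract ht hR h]
    nlinarith [ht.1]

theorem norm_radialRetract_one_le {R : ℝ} (hR : 0 < R) (z : ℂ) :
    ‖radialRetract R 1 z‖ ≤ R := by
  rcases le_total ‖z‖ R with h | h
  · rwa [radialRetract_of_norm_le hR 1 h]
  · rw [norm_radialRetract one_mem hR h]
    simp

theorem radialRetract_mem {R : ℝ} (hR : 0 < R) {E : Set ℂ} (hE : ∀ z : ℂ, R ≤ ‖z‖ → z ∈ E)
    {t : ℝ} (ht : t ∈ I) {z : ℂ} (hz : z ∈ E) : radialRetract R t z ∈ E := by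
  rcases le_total ‖z‖ R with h | h
  · rwa [radialRetract_of_norm_le hR t h]
  · apply hE
    rw [norm_radialRetract ht hR h]
    nlinarith [ht.2]

/-- Lifting the radial retraction through a polynomial which is unbranched over a neighbourhood
`E` of infinity shows that its sublevel sets in `E` are connected. -/
theorem isPreconnected_sublevel {P : ℂ[X]} {E : Set ℂ} (hPE : P.eval ⁻¹' E = E)
    (hEc : IsPreconnected E) (hcrit : ∀ c, P.derivative.eval c = 0 → c ∉ E)
    {R R' : ℝ} (hR : 0 < R) (hRR' : R < R') (hE : ∀ z : ℂ, R ≤ ‖z‖ → z ∈ E) :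
    IsPreconnected (E ∩ {z | ‖P.eval z‖ < R'}) := by
  have hcov : IsCoveringMapOn P.eval E := by
    refine P.isCoveringMapOn_eval.mono ?_
    rintro _ hx ⟨c, hc, rfl⟩
    exact hcrit c hc (hPE ▸ hx)
  have hp := hcov.isCoveringMap_restrictPreimage
  have hmem : ∀ z : P.eval ⁻¹' E, P.eval z.1 ∈ E := fun z => z.2
  let H : C(I × (P.eval ⁻¹' E), E) :=
    ⟨fun q => ⟨radialRetract R q.1 (P.eval q.2.1), radialRetract_mem hR hE q.1.2 (hmem q.2)⟩,
      ((continuous_radialRetract hR).comp (by fun_prop :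
        Continuous fun q : I × (P.eval ⁻¹' E) => ((q.1 : ℝ), P.eval q.2.1))).subtype_mk _⟩
  have H0 : ∀ a, H (0, a) = E.restrictPreimage P.eval (ContinuousMap.id _ a) := by
    intro a
    apply Subtype.ext
    exact radialRetract_zero R _
  let G := hp.liftHomotopy H (ContinuousMap.id _) H0
  have hG : ∀ t a, P.eval (G (t, a)).1 = radialRetract R t (P.eval a.1) := by
    intro t a
    have := congrFun (hp.liftHomotopy_lifts H (ContinuousMap.id _) H0) (t, a)
    exact congrArg Subtype.val this
  have hG0 : ∀ a, G (0, a) = a := fun a => hp.liftHomotopy_zero H (ContinuousMap.id _) H0 a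
  have hGE : ∀ q, (G q).1 ∈ E := fun q => hPE.subset (G q).2
  have : PreconnectedSpace (P.eval ⁻¹' E) := Subtype.preconnectedSpace (hPE.symm ▸ hEc)
  have hpath : ∀ a : P.eval ⁻¹' E, IsPreconnected (range fun t : I => (G (t, a)).1) :=
    fun a => isPreconnected_range (by fun_prop)
  have hpath_sub : ∀ a : P.eval ⁻¹' E, ‖P.eval a.1‖ < R' →
      (range fun t : I => (G (t, a)).1) ⊆ E ∩ {z | ‖P.eval z‖ < R'} := by
    rintro a ha _ ⟨t, rfl⟩
    refine ⟨hGE _, ?_⟩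
    rw [mem_ofPred_eq, hG]
    exact (norm_radialRetract_le hR t.2 _).trans_lt ha
  apply isPreconnected_of_forall_pair
  rintro x ⟨hxE, hx⟩ y ⟨hyE, hy⟩
  let x' : P.eval ⁻¹' E := ⟨x, hPE.symm ▸ hxE⟩
  let y' : P.eval ⁻¹' E := ⟨y, hPE.symm ▸ hyE⟩
  refine ⟨(range fun t : I => (G (t, x')).1) ∪ (range fun a => (G (1, a)).1) ∪
    (range fun t : I => (G (t, y')).1), ?_, ?_, ?_, ?_⟩
  · refine union_subset (union_subset (hpath_sub x' hx) ?_) (hpath_sub y' hy)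
    rintro _ ⟨a, rfl⟩
    refine ⟨hGE _, ?_⟩
    rw [mem_ofPred_eq, hG]
    exact (norm_radialRetract_one_le hR _).trans_lt hRR'
  · exact .inl (.inl ⟨0, by simp [hG0, x']⟩)
  · exact .inr ⟨0, by simp [hG0, y']⟩
  · have hmid : IsPreconnected (range fun a => (G (1, a)).1) := isPreconnected_range (by fun_prop)
    have hleft := IsPreconnected.union (G (1, x')).1 (mem_range_self (1 : I)) (mem_range_self x')
      (hpath x') hmid
    exact IsPreconnected.union (G (1, y')).1 (.inr (mem_range_self y')) (mem_range_self (1 : I))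
      hleft (hpath y')

/-! ### Logarithms and roots outside a connected set of zeros -/

theorem exists_log_ratio {P : ℂ[X]} {S : Set ℂ} (hS : IsPreconnected S) {r : ℝ}
    (hSr : ∀ s ∈ S, ‖P.eval s‖ < r) {a b : ℂ} (ha : a ∈ S) (hb : b ∈ S) :
    ∃ L : ℂ → ℂ, DifferentiableOn ℂ L {z | r < ‖P.eval z‖} ∧
      ∀ z, r < ‖P.eval z‖ → z - b = (z - a) * Complex.exp (L z) := by
  refine hS.induction₂ (fun a b => ∃ L : ℂ → ℂ, DifferentiableOn ℂ L {z | r < ‖P.eval z‖} ∧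
      ∀ z, r < ‖P.eval z‖ → z - b = (z - a) * Complex.exp (L z)) ?_ ?_ ?_ ha hb
  · intro x hx
    have hopen : IsOpen {z | ‖P.eval z‖ < r} := isOpen_lt (by fun_prop) (by fun_prop)
    obtain ⟨δ, hδ, hball⟩ := Metric.isOpen_iff.1 hopen x (hSr x hx)
    filter_upwards [mem_nhdsWithin_of_mem_nhds (Metric.ball_mem_nhds x hδ)] with y hy
    have hne : ∀ z, r < ‖P.eval z‖ → z - x ≠ 0 := by
      intro z hz h
      rw [sub_eq_zero] at h
      exact absurd (hSr x hx) (h ▸ hz.not_gt)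
    have hslit : ∀ z, r < ‖P.eval z‖ → 1 + (x - y) / (z - x) ∈ Complex.slitPlane := by
      intro z hz
      apply Complex.mem_slitPlane_of_norm_lt_one
      rw [norm_div, div_lt_one (norm_pos_iff.2 (hne z hz))]
      by_contra! h
      have hzb : z ∈ Metric.ball x δ := by
        rw [Metric.mem_ball, dist_eq_norm]
        rw [Metric.mem_ball, dist_comm, dist_eq_norm] at hy
        exact h.trans_lt hy
      exact absurd (hball hzb) (not_lt.2 hz.le)
    refine ⟨fun z => Complex.log (1 + (x - y) / (z - x)), ?_, ?_⟩
    · intro z hz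
      apply DifferentiableAt.differentiableWithinAt
      refine DifferentiableAt.clog ?_ (hslit z hz)
      have := hne z hz
      fun_prop (disch := assumption)
    · intro z hz
      rw [Complex.exp_log (Complex.slitPlane_ne_zero (hslit z hz))]
      have := hne z hz
      field_simp
      ring
  · rintro x y z - - - ⟨L, hL, hL'⟩ ⟨M, hM, hM'⟩
    refine ⟨fun z => L z + M z, hL.add hM, fun w hw => ?_⟩
    rw [hM' w hw, hL' w hw, Complex.exp_add]
    ring
  · rintro x y - - ⟨L, hL, hL'⟩
    refine ⟨fun z => -L z, hL.neg, fun w hw => ?_⟩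
    rw [hL' w hw, mul_assoc, ← Complex.exp_add]
    simp

theorem exists_differentiableOn_pow_eq {P : ℂ[X]} (hP : P.natDegree ≠ 0) {S : Set ℂ}
    (hS : IsPreconnected S) {r : ℝ} (hSr : ∀ s ∈ S, ‖P.eval s‖ < r)
    (hroots : ∀ z, P.eval z = 0 → z ∈ S) :
    ∃ g : ℂ → ℂ, DifferentiableOn ℂ g {z | r < ‖P.eval z‖} ∧
      ∀ z, r < ‖P.eval z‖ → g z ^ P.natDegree = P.eval z := by
  have hP0 : P ≠ 0 := by rintro rfl; simp at hP
  obtain ⟨a, ha⟩ := IsAlgClosed.exists_root P (by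
    rw [degree_eq_natDegree hP0]; exact_mod_cast hP)
  have haS : a ∈ S := hroots a ha
  have hprod : ∀ m : Multiset ℂ, (∀ b ∈ m, b ∈ S) →
      ∃ L : ℂ → ℂ, DifferentiableOn ℂ L {z | r < ‖P.eval z‖} ∧ ∀ z, r < ‖P.eval z‖ →
        (m.map fun b => z - b).prod = (z - a) ^ m.card * Complex.exp (L z) := by
    intro m
    induction m using Multiset.induction_on with
    | empty => exact fun _ => ⟨fun _ => 0, differentiableOn_const _, by simp⟩
    | cons b m ih =>
      intro hm
      obtain ⟨L, hL, hL'⟩ := ih fun b hb => hm b (Multiset.mem_cons_of_mem hb)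
      obtain ⟨M, hM, hM'⟩ := exists_log_ratio hS hSr haS (hm b (Multiset.mem_cons_self b m))
      refine ⟨fun z => L z + M z, hL.add hM, fun z hz => ?_⟩
      rw [Multiset.map_cons, Multiset.prod_cons, hL' z hz, hM' z hz, Complex.exp_add,
        Multiset.card_cons]
      ring
  obtain ⟨L, hL, hL'⟩ := hprod P.roots fun b hb => hroots b (isRoot_of_mem_roots hb)
  obtain ⟨μ, hμ⟩ := IsAlgClosed.exists_pow_nat_eq P.leadingCoeff (Nat.pos_of_ne_zero hP)
  refine ⟨fun z => μ * ((z - a) * Complex.exp (L z / P.natDegree)), ?_, fun z hz => ?_⟩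
  · have : DifferentiableOn ℂ (fun z : ℂ => z - a) {z | r < ‖P.eval z‖} := by fun_prop
    exact (this.mul (hL.div_const _).cexp).const_mul _
  · have hs := IsAlgClosed.splits P
    have hN : (P.natDegree : ℂ) ≠ 0 := by exact_mod_cast hP
    rw [hs.eval_eq_prod_roots, hL' z hz, mul_pow, mul_pow, hμ, ← Complex.exp_nat_mul,
      mul_div_cancel₀ _ hN, ← hs.natDegree_eq_card_roots]

/-- If the zeros of `P` lie in a connected set on which `‖P‖ < r`, then all critical values of `P`
have norm at most `r`. -/
theorem norm_eval_le_of_derivative_eq_zero {P : ℂ[X]} (hP : P.natDegree ≠ 0) {S : Set ℂ}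
    (hS : IsPreconnected S) {r : ℝ} (hr : 0 < r) (hSr : ∀ s ∈ S, ‖P.eval s‖ < r)
    (hroots : ∀ z, P.eval z = 0 → z ∈ S) {c : ℂ} (hc : P.derivative.eval c = 0) :
    ‖P.eval c‖ ≤ r := by
  by_contra! hcr
  obtain ⟨g, hg, hgP⟩ := exists_differentiableOn_pow_eq hP hS hSr hroots
  set X : Set ℂ := {z | r < ‖P.eval z‖} with hX
  have hXo : IsOpen X := isOpen_lt (by fun_prop) (by fun_prop)
  have hopen : IsOpen (g '' X) := by
    rw [isOpen_iff_mem_nhds]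
    rintro _ ⟨z, hz, rfl⟩
    have hXz : X ∈ 𝓝 z := hXo.mem_nhds hz
    rcases (hg.analyticAt hXz).eventually_constant_or_nhds_le_map_nhds with h | h
    · refine (not_eventually_eval_eq hP z ?_).elim
      filter_upwards [h, hXz] with x hx hxX
      rw [← hgP x hxX, ← hgP z hz, hx]
    · exact h (image_mem_map hXz)
  have hclosed : closure (g '' X) ∩ {w | r < ‖w ^ P.natDegree‖} ⊆ g '' X := by
    rintro w ⟨hw, hwr⟩
    obtain ⟨u, hu, hlim⟩ := mem_closure_iff_seq_limit.1 hw
    choose z hz hzu using hu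
    have hPz : Tendsto (fun n => P.eval (z n)) atTop (𝓝 (w ^ P.natDegree)) := by
      refine (hlim.pow P.natDegree).congr fun n => ?_
      rw [← hzu, hgP _ (hz n)]
    obtain ⟨M, hM⟩ := (Metric.isBounded_range_of_tendsto _ hPz).exists_norm_le
    have hcpt : IsCompact (P.eval ⁻¹' Metric.closedBall 0 M) :=
      (P.isProperMap_eval (natDegree_pos_iff_degree_pos.1 (Nat.pos_of_ne_zero hP))).isCompact_preimage
        (isCompact_closedBall 0 M)
    obtain ⟨ζ, -, φ, hφ, hζ⟩ := hcpt.tendsto_subseq (x := z) fun n => by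
      simpa using hM _ (mem_range_self n)
    have hPζ : P.eval ζ = w ^ P.natDegree :=
      tendsto_nhds_unique ((P.continuous.tendsto ζ).comp hζ) (hPz.comp hφ.tendsto_atTop)
    have hζX : ζ ∈ X := by rw [hX, mem_ofPred_eq, hPζ]; exact hwr
    refine ⟨ζ, hζX, ?_⟩
    refine tendsto_nhds_unique (((hg.continuousOn.continuousAt (hXo.mem_nhds hζX)).tendsto).comp hζ)
      ((hlim.comp hφ.tendsto_atTop).congr fun n => ?_)
    simp [hzu]
  have hgc : g c ^ P.natDegree = P.eval c := hgP c hcr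
  have hsurj := (isPreconnected_lt_norm_pow hP hr).subset_of_closure_inter_subset hopen
    ⟨g c, by rw [mem_ofPred_eq, hgc]; exact hcr, mem_image_of_mem g hcr⟩ hclosed
  have hgc0 : g c ≠ 0 := by
    intro h
    rw [h, zero_pow hP] at hgc
    rw [← hgc, norm_zero] at hcr
    exact hcr.not_gt hr
  have hζ := Complex.isPrimitiveRoot_exp P.natDegree hP
  set ζ := Complex.exp (2 * Real.pi * Complex.I / P.natDegree)
  have hpow : ∀ k : ℕ, (ζ ^ k * g c) ^ P.natDegree = P.eval c := by
    intro k
    rw [mul_pow, ← pow_mul, mul_comm k, pow_mul, hζ.pow_eq_one, one_pow, one_mul, hgc]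
  have hex : ∀ k : ℕ, ∃ z ∈ X, g z = ζ ^ k * g c := fun k =>
    hsurj (by rw [mem_ofPred_eq, hpow]; exact hcr)
  choose z hzX hz using hex
  set Q : ℂ[X] := P - C (P.eval c) with hQ
  have hQN : Q.natDegree = P.natDegree := natDegree_sub_C
  have hQ0 : Q ≠ 0 := by
    intro h
    rw [h, natDegree_zero] at hQN
    exact hP hQN.symm
  have hcard : P.natDegree ≤ Q.roots.toFinset.card := by
    rw [← Finset.card_range P.natDegree]
    refine Finset.card_le_card_of_injOn z ?_ ?_
    · intro k _
      rw [Finset.mem_coe, Multiset.mem_toFinset, mem_roots hQ0, IsRoot, hQ, eval_sub, eval_C,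
        ← hgP _ (hzX k), hz, hpow, sub_self]
    · intro i hi j hj hij
      have h : ζ ^ i * g c = ζ ^ j * g c := by rw [← hz, ← hz, hij]
      exact hζ.pow_inj (by simpa using hi) (by simpa using hj) (mul_right_cancel₀ hgc0 h)
  have hnodup : Q.roots.Nodup := by
    rw [← Multiset.toFinset_card_eq_card_iff_nodup]
    exact le_antisymm (Multiset.toFinset_card_le _) ((Q.card_roots'.trans hQN.le).trans hcard)
  have hone := Multiset.nodup_iff_count_le_one.1 hnodup c
  rw [count_roots] at hone
  refine hone.not_gt ((one_lt_rootMultiplicity_iff_isRoot hQ0).2 ⟨?_, ?_⟩)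
  · simp [hQ]
  · simp [hQ, hc]

/-! ### The filled-in Julia set -/

/-- The set of points with bounded forward orbit. -/
def filledJulia (f : ℂ[X]) : Set ℂ :=
  {z | Bornology.IsBounded (range fun n : ℕ => (fun w : ℂ => f.eval w)^[n] z)}

section Escape

variable {f : ℂ[X]} {R : ℝ}

theorem le_norm_iterate (hR : 0 < R) (hf : ∀ z : ℂ, R ≤ ‖z‖ → 2 * ‖z‖ ≤ ‖f.eval z‖) {z : ℂ}
    (hz : R ≤ ‖z‖) (n : ℕ) : 2 ^ n * R ≤ ‖(fun w : ℂ => f.eval w)^[n] z‖ := by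
  induction n with
  | zero => simpa using hz
  | succ n ih =>
    rw [Function.iterate_succ_apply']
    have h1 : R ≤ ‖(fun w : ℂ => f.eval w)^[n] z‖ :=
      le_trans (le_mul_of_one_le_left hR.le (one_le_pow₀ one_le_two)) ih
    have := hf _ h1
    rw [pow_succ]
    linarith

theorem tendsto_norm_iterate (hR : 0 < R) (hf : ∀ z : ℂ, R ≤ ‖z‖ → 2 * ‖z‖ ≤ ‖f.eval z‖) {z : ℂ}
    {m : ℕ} (hz : R ≤ ‖(fun w : ℂ => f.eval w)^[m] z‖) :
    Tendsto (fun n => ‖(fun w : ℂ => f.eval w)^[n] z‖) atTop atTop := by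
  rw [← tendsto_add_atTop_iff_nat m]
  refine tendsto_atTop_mono (fun n => ?_)
    ((tendsto_pow_atTop_atTop_of_one_lt one_lt_two).atTop_mul_const hR)
  rw [Function.iterate_add_apply]
  exact le_norm_iterate hR hf hz n

theorem mem_filledJulia_iff (hR : 0 < R) (hf : ∀ z : ℂ, R ≤ ‖z‖ → 2 * ‖z‖ ≤ ‖f.eval z‖) {z : ℂ} :
    z ∈ filledJulia f ↔ ∀ n : ℕ, ‖(fun w : ℂ => f.eval w)^[n] z‖ ≤ R := by
  constructor
  · intro h n
    by_contra! hn
    obtain ⟨M, hM⟩ := Bornology.IsBounded.exists_norm_le (mem_ofPred_eq ▸ h)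
    obtain ⟨k, hk⟩ := ((tendsto_norm_iterate hR hf hn.le).eventually_gt_atTop M).exists
    exact hk.not_ge (hM _ (mem_range_self k))
  · intro h
    rw [filledJulia, mem_ofPred_eq, isBounded_iff_forall_norm_le]
    refine ⟨R, ?_⟩
    rintro _ ⟨n, rfl⟩
    exact h n

theorem tendsto_norm_iterate_of_notMem (hR : 0 < R)
    (hf : ∀ z : ℂ, R ≤ ‖z‖ → 2 * ‖z‖ ≤ ‖f.eval z‖) {z : ℂ} (hz : z ∉ filledJulia f) :
    Tendsto (fun n => ‖(fun w : ℂ => f.eval w)^[n] z‖) atTop atTop := by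
  rw [mem_filledJulia_iff hR hf] at hz
  push Not at hz
  obtain ⟨m, hm⟩ := hz
  exact tendsto_norm_iterate hR hf hm.le

theorem notMem_filledJulia_of_le_norm (hR : 0 < R)
    (hf : ∀ z : ℂ, R ≤ ‖z‖ → 2 * ‖z‖ ≤ ‖f.eval z‖) {z : ℂ} (hz : R ≤ ‖z‖) :
    z ∉ filledJulia f := by
  intro h
  have h1 := (mem_filledJulia_iff hR hf).1 h 1
  have h2 := hf z hz
  simp only [Function.iterate_one] at h1
  linarith

theorem eval_mem_filledJulia_iff (hR : 0 < R)
    (hf : ∀ z : ℂ, R ≤ ‖z‖ → 2 * ‖z‖ ≤ ‖f.eval z‖) {z : ℂ} :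
    f.eval z ∈ filledJulia f ↔ z ∈ filledJulia f := by
  constructor
  · contrapose!
    intro h hz
    have ht := (tendsto_norm_iterate_of_notMem hR hf h)
    rw [← tendsto_add_atTop_iff_nat 1] at ht
    obtain ⟨n, hn⟩ := (ht.eventually_gt_atTop R).exists
    rw [Function.iterate_add_apply, Function.iterate_one] at hn
    exact hn.not_ge ((mem_filledJulia_iff hR hf).1 hz n)
  · intro h
    rw [mem_filledJulia_iff hR hf] at h ⊢
    intro n
    exact h (n + 1)

theorem continuous_iterate_eval (f : ℂ[X]) (n : ℕ) :
    Continuous ((fun w : ℂ => f.eval w)^[n]) := f.continuous.iterate n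

theorem isClosed_filledJulia (hR : 0 < R) (hf : ∀ z : ℂ, R ≤ ‖z‖ → 2 * ‖z‖ ≤ ‖f.eval z‖) :
    IsClosed (filledJulia f) := by
  have : filledJulia f = ⋂ n : ℕ, {z | ‖(fun w : ℂ => f.eval w)^[n] z‖ ≤ R} := by
    ext z
    simp [mem_filledJulia_iff hR hf]
  rw [this]
  exact isClosed_iInter fun n => isClosed_le (continuous_iterate_eval f n).norm continuous_const

theorem preimage_iterate_filledJulia (hR : 0 < R)
    (hf : ∀ z : ℂ, R ≤ ‖z‖ → 2 * ‖z‖ ≤ ‖f.eval z‖) (n : ℕ) :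
    (fun w : ℂ => f.eval w)^[n] ⁻¹' filledJulia f = filledJulia f := by
  induction n with
  | zero => rfl
  | succ n ih =>
    ext z
    rw [mem_preimage, Function.iterate_succ_apply', eval_mem_filledJulia_iff hR hf, ← mem_preimage,
      ih]

theorem isPreconnected_compl_filledJulia (hR : 0 < R)
    (hf : ∀ z : ℂ, R ≤ ‖z‖ → 2 * ‖z‖ ≤ ‖f.eval z‖) : IsPreconnected (filledJulia f)ᶜ := by
  have hopen : IsOpen (filledJulia f)ᶜ := (isClosed_filledJulia hR hf).isOpen_compl
  set O : Set ℂ := {w | R < ‖w‖} with hO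
  have hOc : IsPreconnected O := by simpa using isPreconnected_lt_norm_pow one_ne_zero hR
  have hOK : O ⊆ (filledJulia f)ᶜ := fun z hz => notMem_filledJulia_of_le_norm hR hf (le_of_lt hz)
  have hmeet : ∀ z ∈ (filledJulia f)ᶜ,
      (connectedComponentIn (filledJulia f)ᶜ z ∩ O).Nonempty := by
    intro z hz
    by_contra hne
    have hsub : connectedComponentIn (filledJulia f)ᶜ z ⊆ Metric.closedBall 0 R := by
      intro w hw
      rw [mem_closedBall_zero_iff]
      by_contra! h
      exact hne ⟨w, hw, h⟩
    have hfr : frontier (connectedComponentIn (filledJulia f)ᶜ z) ⊆ filledJulia f := fun x hx => by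
      by_contra h
      exact Set.disjoint_left.1 (disjoint_frontier_connectedComponentIn hopen z) hx h
    apply hz
    rw [mem_filledJulia_iff hR hf]
    intro n
    have hd : Differentiable ℂ ((fun w : ℂ => f.eval w)^[n]) := f.differentiable.iterate n
    exact Complex.norm_le_of_forall_mem_frontier_norm_le
      (Metric.isBounded_closedBall.subset hsub) hd.diffContOnCl
      (fun w hw => (mem_filledJulia_iff hR hf).1 (hfr hw) n)
      (subset_closure (mem_connectedComponentIn hz))
  obtain ⟨p, hp⟩ : O.Nonempty := ⟨((R + 1 : ℝ) : ℂ), by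
    rw [hO, mem_ofPred_eq, Complex.norm_real, Real.norm_of_nonneg] <;> linarith⟩
  refine isPreconnected_of_forall p fun z hz =>
    ⟨O ∪ connectedComponentIn (filledJulia f)ᶜ z,
      union_subset hOK (connectedComponentIn_subset _ _), .inl hp,
      .inr (mem_connectedComponentIn hz), ?_⟩
  obtain ⟨q, hq, hqO⟩ := hmeet z hz
  exact IsPreconnected.union q hqO hq hOc isPreconnected_connectedComponentIn

theorem eval_iterate_comp (f : ℂ[X]) (n : ℕ) (z : ℂ) :
    (f.comp^[n] X).eval z = (fun w : ℂ => f.eval w)^[n] z := by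
  rw [iterate_comp_eval, eval_X]

theorem mem_filledJulia_of_derivative_iterate_eq_zero (hR : 0 < R)
    (hf : ∀ z : ℂ, R ≤ ‖z‖ → 2 * ‖z‖ ≤ ‖f.eval z‖)
    (hcrit : ∀ c, f.derivative.eval c = 0 → c ∈ filledJulia f) (n : ℕ) {c : ℂ}
    (hc : (f.comp^[n] X).derivative.eval c = 0) : c ∈ filledJulia f := by
  induction n with
  | zero => simp at hc
  | succ n ih =>
    rw [Function.iterate_succ_apply', derivative_comp, eval_mul, mul_eq_zero, eval_comp,
      eval_iterate_comp] at hc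
    rcases hc with hc | hc
    · exact ih hc
    · have := hcrit _ hc
      rwa [← mem_preimage, preimage_iterate_filledJulia hR hf] at this

theorem derivative_iterate_eq_zero {c : ℂ} (hc : f.derivative.eval c = 0) (n : ℕ) :
    (f.comp^[n + 1] X).derivative.eval c = 0 := by
  induction n with
  | zero => simp [hc]
  | succ n ih =>
    rw [Function.iterate_succ_apply', derivative_comp, eval_mul, ih, zero_mul]

theorem natDegree_iterate_comp_X (f : ℂ[X]) (n : ℕ) :
    (f.comp^[n] X).natDegree = f.natDegree ^ n := by
  rw [natDegree_iterate_comp, natDegree_X, mul_one]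

theorem isPreconnected_frontier_filledJulia (hR : 0 < R)
    (hf : ∀ z : ℂ, R ≤ ‖z‖ → 2 * ‖z‖ ≤ ‖f.eval z‖)
    (hcrit : ∀ c, f.derivative.eval c = 0 → c ∈ filledJulia f) :
    IsPreconnected (frontier (filledJulia f)) := by
  set K := filledJulia f with hK
  set F : ℂ → ℂ := fun w : ℂ => f.eval w with hF
  let W : ℕ → Set ℂ := fun n => Kᶜ ∩ {z | ‖F^[n] z‖ < R + 1}
  have hmono : ∀ (n : ℕ) {z : ℂ}, ‖F^[n + 1] z‖ < R + 1 → ‖F^[n] z‖ < R + 1 := by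
    intro n z hz
    by_contra! h
    have := hf (F^[n] z) (by linarith)
    rw [Function.iterate_succ_apply'] at hz
    change ‖f.eval (F^[n] z)‖ < R + 1 at hz
    linarith
  have hWanti : Antitone W := antitone_nat_of_succ_le fun n z hz => ⟨hz.1, hmono n hz.2⟩
  have hWpre : ∀ n, IsPreconnected (W n) := by
    intro n
    have h := isPreconnected_sublevel (P := f.comp^[n] X) (E := Kᶜ) (R := R) (R' := R + 1)
      (by
        have := preimage_iterate_filledJulia hR hf n
        ext z
        rw [mem_preimage, eval_iterate_comp, ← mem_preimage, preimage_compl, this])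
      (isPreconnected_compl_filledJulia hR hf)
      (fun c hc h => h (mem_filledJulia_of_derivative_iterate_eq_zero hR hf hcrit n hc))
      hR (by linarith) (fun z hz => notMem_filledJulia_of_le_norm hR hf hz)
    simpa only [eval_iterate_comp] using h
  have hsub : ∀ n, closure (W n) ⊆ {z | ‖F^[n] z‖ ≤ R + 1} := fun n =>
    closure_minimal (fun z hz => mem_ofPred.2 (le_of_lt hz.2))
      (isClosed_le (continuous_iterate_eval f n).norm continuous_const)
  have hcpt : ∀ n, IsCompact (closure (W n)) := by
    intro n
    refine (isCompact_closedBall (0 : ℂ) (R + 1)).of_isClosed_subset isClosed_closure ?_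
    intro z hz
    have := hsub 0 (closure_mono (hWanti (Nat.zero_le n)) hz)
    simpa using this
  have heq : frontier K = ⋂ n, closure (W n) := by
    rw [frontier_eq_closure_inter_closure, (isClosed_filledJulia hR hf).closure_eq]
    ext z
    rw [mem_iInter]
    constructor
    · rintro ⟨hz, hzE⟩ n
      have hU : IsOpen {z | ‖F^[n] z‖ < R + 1} :=
        isOpen_lt (continuous_iterate_eval f n).norm continuous_const
      have hzU : z ∈ {z | ‖F^[n] z‖ < R + 1} :=
        lt_of_le_of_lt ((mem_filledJulia_iff hR hf).1 hz n) (lt_add_one R)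
      exact (inter_comm _ _ ▸ hU.inter_closure ⟨hzU, hzE⟩ : z ∈ closure (Kᶜ ∩ _))
    · intro h
      refine ⟨?_, closure_mono inter_subset_left (h 0)⟩
      by_contra hz
      obtain ⟨n, hn⟩ :=
        ((tendsto_norm_iterate_of_notMem hR hf hz).eventually_gt_atTop (R + 1)).exists
      exact hn.not_ge (hsub n (h n))
  rw [heq]
  exact isPreconnected_iInter_of_antitone (fun m n h => closure_mono (hWanti h)) hcpt
    fun n => (hWpre n).closure

theorem nonempty_frontier_filledJulia (hdeg : 2 ≤ f.natDegree) (hR : 0 < R)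
    (hf : ∀ z : ℂ, R ≤ ‖z‖ → 2 * ‖z‖ ≤ ‖f.eval z‖) : (frontier (filledJulia f)).Nonempty := by
  rw [nonempty_frontier_iff]
  constructor
  · have hnd : (f - X).natDegree = f.natDegree :=
      natDegree_sub_eq_left_of_natDegree_lt (by rw [natDegree_X]; omega)
    obtain ⟨z, hz⟩ := IsAlgClosed.exists_root (f - X)
      (natDegree_pos_iff_degree_pos.1 (by omega)).ne'
    have hfix : f.eval z = z := by simpa [IsRoot, sub_eq_zero] using hz
    refine ⟨z, ?_⟩
    have : ∀ n : ℕ, (fun w : ℂ => f.eval w)^[n] z = z := Function.iterate_fixed hfix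
    simp [filledJulia, this]
  · rw [Ne, eq_univ_iff_forall]
    intro h
    refine notMem_filledJulia_of_le_norm hR hf (z := (R : ℂ)) ?_ (h _)
    rw [Complex.norm_real]
    exact le_abs_self R

theorem critical_mem_filledJulia (hdeg : 2 ≤ f.natDegree) (hR : 0 < R)
    (hf : ∀ z : ℂ, R ≤ ‖z‖ → 2 * ‖z‖ ≤ ‖f.eval z‖)
    (hJ : IsConnected (frontier (filledJulia f))) {c : ℂ} (hc : f.derivative.eval c = 0) :
    c ∈ filledJulia f := by
  by_contra hcK
  obtain ⟨a, ha⟩ := hJ.nonempty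
  have hJK : frontier (filledJulia f) ⊆ filledJulia f := (isClosed_filledJulia hR hf).frontier_subset
  have hnorm : ∀ z ∈ filledJulia f, ‖z‖ ≤ R := fun z hz => (mem_filledJulia_iff hR hf).1 hz 0
  have ht := tendsto_norm_iterate_of_notMem hR hf hcK
  rw [← tendsto_add_atTop_iff_nat 1] at ht
  obtain ⟨n, hn⟩ := (ht.eventually_gt_atTop (3 * R + 1)).exists
  set P : ℂ[X] := f.comp^[n + 1] X - C a with hP
  have hPeval : ∀ z, P.eval z = (fun w : ℂ => f.eval w)^[n + 1] z - a := by
    intro z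
    rw [hP, eval_sub, eval_C, eval_iterate_comp]
  have hdeg' : (f.comp^[n + 1] X).natDegree ≠ 0 := by
    rw [natDegree_iterate_comp_X]
    exact pow_ne_zero _ (by omega)
  have hpre : (fun w : ℂ => f.eval w)^[n + 1] ⁻¹' frontier (filledJulia f) =
      frontier (filledJulia f) := by
    have hopen : IsOpenMap ((fun w : ℂ => f.eval w)^[n + 1]) := by
      have := isOpenMap_eval hdeg'
      simpa only [eval_iterate_comp] using this
    rw [hopen.preimage_frontier_eq_frontier_preimage (continuous_iterate_eval f _),
      preimage_iterate_filledJulia hR hf]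
  have hle := norm_eval_le_of_derivative_eq_zero (P := P) (r := 2 * R + 1) (c := c)
    (by rwa [hP, natDegree_sub_C]) hJ.isPreconnected (by linarith)
    (fun s hs => by
      rw [hPeval]
      have h1 := (mem_filledJulia_iff hR hf).1 (hJK hs) (n + 1)
      have h2 := hnorm a (hJK ha)
      have h3 := norm_sub_le ((fun w : ℂ => f.eval w)^[n + 1] s) a
      linarith)
    (fun z hz => by
      rw [hPeval, sub_eq_zero] at hz
      rw [← hpre, mem_preimage, hz]
      exact ha)
    (by rw [hP, derivative_sub, derivative_C, sub_zero]; exact derivative_iterate_eq_zero hc n)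
  rw [hPeval] at hle
  have h2 := hnorm a (hJK ha)
  have h3 := norm_sub_norm_le ((fun w : ℂ => f.eval w)^[n + 1] c) a
  linarith

end Escape

end PolynomialDynamics

/-- **Fatou–Julia.** The Julia set of a complex polynomial of degree `≥ 2` is connected
if and only if every critical point has bounded forward orbit (lies in the filled-in
Julia set). -/
theorem julia_connected_iff_critical_points_bounded
    (f : Polynomial ℂ) (d : ℕ) (hd : 2 ≤ d) (hdeg : f.natDegree = d)
    (Kf : Set ℂ)
    (hKf : Kf = {z : ℂ | Bornology.IsBounded
      (Set.range fun n : ℕ => (fun w : ℂ => f.eval w)^[n] z)})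
    (Jf : Set ℂ) (hJf : Jf = frontier Kf) :
    IsConnected Jf ↔ (∀ c : ℂ, f.derivative.eval c = 0 → c ∈ Kf) := by
  subst hdeg
  obtain ⟨R, hR, hf⟩ := PolynomialDynamics.exists_two_mul_norm_le_norm_eval hd
  obtain rfl : Kf = PolynomialDynamics.filledJulia f := hKf
  subst hJf
  exact ⟨fun hJ c hc => PolynomialDynamics.critical_mem_filledJulia hd hR hf hJ hc, fun h =>
    ⟨PolynomialDynamics.nonempty_frontier_filledJulia hd hR hf,
      PolynomialDynamics.isPreconnected_frontier_filledJulia hR hf h⟩⟩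
end
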